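/- arXiv:2307.14871 — 2 statements merged into one kernel-verified Lean document; each statement's English description precedes it below -/
import Mathlib

section
/- Let ε > 0, let α ∈ 𝒦, and let γ ∈ ℝ. Then there exists a set 𝒢 ⊆ Bad with Hausdorff dimension dim_H(𝒢) = 1 such that for every β ∈ 𝒢 and every δ ∈ ℝ, there exist c > 0 and N_0 such that for all N ≥ N_0, #{n ∈ ℕ : n ≤ N and n · ‖nα − γ‖ · ‖nβ − δ‖ < (log log n)^(3+ε)/log n} ≥ c · log log N. -/
open Real MeasureTheory Set

/-- Distance from `x` to the nearest integer. -/
noncomputable def nint (x : ℝ) : ℝ := ⨅ n : ℤ, |x - n|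

/-- The set of badly approximable numbers. -/
def Bad : Set ℝ := {α : ℝ | ∃ c > 0, ∀ n : ℕ, 1 ≤ n → c ≤ n * nint (n * α)}

/-- The set of `δ`-inhomogeneously badly approximable numbers. -/
def BadShift (δ : ℝ) : Set ℝ := {β : ℝ | ∃ c > 0, ∀ n : ℕ, 1 ≤ n → c ≤ n * nint (n * β - δ)}

/-- The set `ℬ = {(β, δ) : β ∈ Bad ∩ Bad(δ)}`. -/
def calB : Set (ℝ × ℝ) := {p : ℝ × ℝ | p.1 ∈ Bad ∧ p.1 ∈ BadShift p.2}

/-- The `k`-th continuant `q_k(α)` (denominator of the `k`-th convergent) of the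
continued fraction expansion of `α`. -/
noncomputable def contDen (α : ℝ) (k : ℕ) : ℝ := (GenContFract.of α).dens k

/-- `Λ(α) = sup_{k ≥ 1} (log q_k(α)) / k`. -/
noncomputable def Lam (α : ℝ) : ℝ := ⨆ k : ℕ+, Real.log (contDen α k) / k

/-- Membership in the set `𝒦` of irrational numbers with `Λ(α) < ∞`. -/
def memK (α : ℝ) : Prop :=
  Irrational α ∧ BddAbove (Set.range fun k : ℕ+ => Real.log (contDen α k) / k)

/-- The Fourier transform `μ̂(ξ) = ∫ e^{-2πiξx} dμ(x)` of a measure `μ` on `ℝ`. -/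
noncomputable def mFT (μ : Measure ℝ) (ξ : ℝ) : ℂ :=
  ∫ x, Complex.exp (-(2 * Real.pi * ξ * x : ℝ) * Complex.I) ∂μ

/-- Dispersion of a (finite) set `A ⊆ [0,1)`: the largest gap between circularly
consecutive elements, where the gap between the largest and the smallest element
wraps around, i.e. equals `min A + 1 - max A`. -/
noncomputable def disp (A : Set ℝ) : ℝ :=
  sSup {d : ℝ |
    (∃ a ∈ A, ∃ b ∈ A, a < b ∧ (∀ x ∈ A, x ≤ a ∨ b ≤ x) ∧ d = b - a) ∨
    (∃ a ∈ A, ∃ b ∈ A, (∀ x ∈ A, b ≤ x ∧ x ≤ a) ∧ d = b + 1 - a)}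

/-- Integral Möbius maps `t ↦ (a + b t) / (c + d t)` of determinant one preserving `[0, 1]`,
with distortion at most four. -/
@[ext] structure Mob where
  a : ℤ
  b : ℤ
  c : ℤ
  d : ℤ
  a_nonneg : 0 ≤ a
  b_nonneg : 0 ≤ b
  one_le_c : 1 ≤ c
  d_nonneg : 0 ≤ d
  det : b * c - a * d = 1
  a_le_c : a ≤ c
  ab_le_cd : a + b ≤ c + d
  d_le_c : d ≤ c
  bd_le_ac : b + d ≤ a + c

namespace Mob

instance : One Mob := ⟨⟨0, 1, 1, 0, by norm_num, by norm_num, by norm_num, by norm_num,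
  by norm_num, by norm_num, by norm_num, by norm_num, by norm_num⟩⟩

instance : Mul Mob := ⟨fun g h =>
  { a := g.a * h.c + g.b * h.a
    b := g.a * h.d + g.b * h.b
    c := g.c * h.c + g.d * h.a
    d := g.c * h.d + g.d * h.b
    a_nonneg := by
      have := g.a_nonneg; have := g.b_nonneg; have := h.a_nonneg; have := h.one_le_c
      positivity
    b_nonneg := by
      have := g.a_nonneg; have := g.b_nonneg; have := h.b_nonneg; have := h.d_nonneg
      positivity
    one_le_c := by
      have := g.d_nonneg; have := g.one_le_c; have := h.a_nonneg; have := h.one_le_c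
      have : 0 ≤ g.d * h.a := by positivity
      nlinarith
    d_nonneg := by
      have := g.d_nonneg; have := g.one_le_c; have := h.d_nonneg; have := h.b_nonneg
      positivity
    det := by
      linear_combination h.b * h.c * g.det - h.a * h.d * g.det + h.det
    a_le_c := by
      nlinarith [mul_nonneg (sub_nonneg.2 g.a_le_c) (sub_nonneg.2 h.a_le_c),
        mul_nonneg (sub_nonneg.2 g.ab_le_cd) h.a_nonneg]
    ab_le_cd := by
      nlinarith [mul_nonneg (sub_nonneg.2 g.a_le_c) (sub_nonneg.2 h.ab_le_cd),
        mul_nonneg (sub_nonneg.2 g.ab_le_cd) (add_nonneg h.a_nonneg h.b_nonneg)]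
    d_le_c := by
      nlinarith [mul_nonneg (sub_nonneg.2 g.d_le_c) (sub_nonneg.2 h.d_le_c),
        mul_nonneg (sub_nonneg.2 h.bd_le_ac) g.d_nonneg]
    bd_le_ac := by
      nlinarith [mul_nonneg (sub_nonneg.2 g.bd_le_ac) (sub_nonneg.2 h.d_le_c),
        mul_nonneg (sub_nonneg.2 h.bd_le_ac) (add_nonneg g.b_nonneg g.d_nonneg)] }⟩

@[simp] lemma one_a : (1 : Mob).a = 0 := rfl
@[simp] lemma one_b : (1 : Mob).b = 1 := rfl
@[simp] lemma one_c : (1 : Mob).c = 1 := rfl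
@[simp] lemma one_d : (1 : Mob).d = 0 := rfl
@[simp] lemma mul_a (g h : Mob) : (g * h).a = g.a * h.c + g.b * h.a := rfl
@[simp] lemma mul_b (g h : Mob) : (g * h).b = g.a * h.d + g.b * h.b := rfl
@[simp] lemma mul_c (g h : Mob) : (g * h).c = g.c * h.c + g.d * h.a := rfl
@[simp] lemma mul_d (g h : Mob) : (g * h).d = g.c * h.d + g.d * h.b := rfl

instance : Monoid Mob where
  mul_assoc g h k := by ext <;> simp <;> ring
  one_mul g := by ext <;> simp
  mul_one g := by ext <;> simp

/-- The Möbius map itself. -/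
noncomputable def f (g : Mob) (t : ℝ) : ℝ := (g.a + g.b * t) / (g.c + g.d * t)

lemma c_ge (g : Mob) : (1 : ℝ) ≤ g.c := by exact_mod_cast g.one_le_c
lemma c_pos (g : Mob) : (0 : ℝ) < g.c := lt_of_lt_of_le one_pos g.c_ge
lemma d_ge (g : Mob) : (0 : ℝ) ≤ g.d := by exact_mod_cast g.d_nonneg
lemma a_ge (g : Mob) : (0 : ℝ) ≤ g.a := by exact_mod_cast g.a_nonneg
lemma b_ge (g : Mob) : (0 : ℝ) ≤ g.b := by exact_mod_cast g.b_nonneg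
lemma d_le (g : Mob) : (g.d : ℝ) ≤ g.c := by exact_mod_cast g.d_le_c
lemma a_le (g : Mob) : (g.a : ℝ) ≤ g.c := by exact_mod_cast g.a_le_c
lemma ab_le (g : Mob) : (g.a + g.b : ℝ) ≤ g.c + g.d := by exact_mod_cast g.ab_le_cd
lemma detR (g : Mob) : (g.b * g.c - g.a * g.d : ℝ) = 1 := by exact_mod_cast g.det

lemma den_ge (g : Mob) {t : ℝ} (ht : 0 ≤ t) : (g.c : ℝ) ≤ g.c + g.d * t :=
  le_add_of_nonneg_right (mul_nonneg g.d_ge ht)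

lemma den_pos (g : Mob) {t : ℝ} (ht : 0 ≤ t) : (0 : ℝ) < g.c + g.d * t :=
  lt_of_lt_of_le g.c_pos (g.den_ge ht)

lemma den_le (g : Mob) {t : ℝ} (ht : t ≤ 1) : (g.c + g.d * t : ℝ) ≤ 2 * g.c := by
  nlinarith [g.d_ge, g.d_le]

lemma f_nonneg (g : Mob) {t : ℝ} (ht : 0 ≤ t) : 0 ≤ g.f t :=
  div_nonneg (add_nonneg g.a_ge (mul_nonneg g.b_ge ht)) (g.den_pos ht).le

lemma f_le_one (g : Mob) {t : ℝ} (ht : t ∈ Icc (0 : ℝ) 1) : g.f t ≤ 1 := by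
  rw [f, div_le_one (g.den_pos ht.1)]
  nlinarith [mul_nonneg (sub_nonneg.2 g.a_le) (sub_nonneg.2 ht.2),
    mul_nonneg (sub_nonneg.2 g.ab_le) ht.1]

lemma f_mem (g : Mob) {t : ℝ} (ht : t ∈ Icc (0 : ℝ) 1) : g.f t ∈ Icc (0 : ℝ) 1 :=
  ⟨g.f_nonneg ht.1, g.f_le_one ht⟩

lemma f_mul (g h : Mob) {t : ℝ} (ht : 0 ≤ t) : (g * h).f t = g.f (h.f t) := by
  have h1 := h.den_pos ht
  have h3 := h1.ne'
  unfold f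
  have h4 : (g.c : ℝ) + g.d * ((h.a + h.b * t) / (h.c + h.d * t)) =
      ((g * h).c + (g * h).d * t) / (h.c + h.d * t) := by
    rw [eq_div_iff h3, add_mul, mul_assoc, div_mul_cancel₀ _ h3]; push_cast [mul_c, mul_d]; ring
  have h5 : (g.a : ℝ) + g.b * ((h.a + h.b * t) / (h.c + h.d * t)) =
      ((g * h).a + (g * h).b * t) / (h.c + h.d * t) := by
    rw [eq_div_iff h3, add_mul, mul_assoc, div_mul_cancel₀ _ h3]; push_cast [mul_a, mul_b]; ring
  rw [h4, h5, div_div_div_cancel_right₀ h1.ne']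

lemma f_zero (g : Mob) : g.f 0 = g.a / g.c := by simp [f]

lemma f_sub (g : Mob) {x y : ℝ} (hx : 0 ≤ x) (hy : 0 ≤ y) :
    g.f x - g.f y = (x - y) / ((g.c + g.d * x) * (g.c + g.d * y)) := by
  have h1 := g.den_pos hx
  have h2 := g.den_pos hy
  unfold f
  rw [div_sub_div _ _ h1.ne' h2.ne']
  congr 1
  linear_combination (x - y) * g.detR

lemma abs_f_sub_le (g : Mob) {x y : ℝ} (hx : 0 ≤ x) (hy : 0 ≤ y) :
    |g.f x - g.f y| ≤ |x - y| / (g.c : ℝ) ^ 2 := by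
  have h1 := g.den_pos hx
  have h2 := g.den_pos hy
  have := g.c_pos
  rw [g.f_sub hx hy, abs_div, abs_of_pos (mul_pos h1 h2), sq]
  gcongr
  · exact g.den_ge hx
  · exact g.den_ge hy

lemma le_abs_f_sub (g : Mob) {x y : ℝ} (hx : x ∈ Icc (0 : ℝ) 1) (hy : y ∈ Icc (0 : ℝ) 1) :
    |x - y| / (4 * (g.c : ℝ) ^ 2) ≤ |g.f x - g.f y| := by
  have h1 := g.den_pos hx.1
  have h2 := g.den_pos hy.1
  have := g.c_pos
  rw [g.f_sub hx.1 hy.1, abs_div, abs_of_pos (mul_pos h1 h2),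
    show (4 * (g.c : ℝ) ^ 2) = (2 * g.c) * (2 * g.c) by ring]
  gcongr
  · exact g.den_le hx.2
  · exact g.den_le hy.2

lemma c_mul_le (g h : Mob) : ((g * h).c : ℝ) ≤ 2 * (g.c * h.c) := by
  push_cast [mul_c]
  nlinarith [mul_le_mul g.d_le h.a_le h.a_ge g.c_pos.le]

lemma le_c_mul (g h : Mob) : (g.c * h.c : ℝ) ≤ (g * h).c := by
  push_cast [mul_c]
  nlinarith [mul_nonneg g.d_ge h.a_ge]

lemma c_le_mul_left (g h : Mob) : (g.c : ℝ) ≤ (g * h).c := by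
  nlinarith [le_c_mul g h, g.c_pos, h.c_ge]

end Mob

/-- A finite alphabet of Möbius maps with well separated images and almost full dimension. -/
structure Adm (U : Finset Mob) (D : ℕ) : Prop where
  two_le : ∀ g ∈ U, (2 : ℝ) ≤ g.c
  le_D : ∀ g ∈ U, 2 * (g.c : ℝ) ≤ D
  sep : ∀ g ∈ U, ∀ h ∈ U, g ≠ h → ∀ t ∈ Icc (0 : ℝ) 1, ∀ t' ∈ Icc (0 : ℝ) 1,
    1 / (D : ℝ) ^ 2 ≤ |g.f t - h.f t'|
  card_ge : (D : ℝ) ^ 9 ≤ (U.card : ℝ) ^ 5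
  D_ge : (2 : ℝ) ^ 10 ≤ D

namespace Adm

variable {U : Finset Mob} {D : ℕ}

/-- The monoid generated by the alphabet. -/
abbrev cl (U : Finset Mob) : Submonoid Mob := Submonoid.closure (U : Set Mob)

lemma one_le_D (hU : Adm U D) : (1 : ℝ) ≤ D := le_trans (by norm_num) hU.D_ge

lemma D_pos (hU : Adm U D) : (0 : ℝ) < D := lt_of_lt_of_le one_pos hU.one_le_D

lemma nonempty (hU : Adm U D) : U.Nonempty := by
  rw [← Finset.card_pos]
  by_contra h
  have h0 : U.card = 0 := by omega
  have h1 := hU.card_ge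
  have h2 : (0 : ℝ) < (D : ℝ) ^ 9 := pow_pos hU.D_pos 9
  rw [h0] at h1
  norm_num at h1
  linarith

lemma exists_words (hU : Adm U D) (l : ℕ) : ∃ S : Finset Mob, (∀ g ∈ S, g ∈ cl U) ∧
    S.card = U.card ^ l ∧ (∀ g ∈ S, (g.c : ℝ) ≤ (D : ℝ) ^ l) ∧
    ∀ g ∈ S, ∀ h ∈ S, g ≠ h → ∀ t ∈ Icc (0 : ℝ) 1, ∀ t' ∈ Icc (0 : ℝ) 1,
      1 / (D : ℝ) ^ (2 * l) ≤ |g.f t - h.f t'| := by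
  classical
  have hD := hU.D_pos
  induction l with
  | zero =>
    refine ⟨{1}, ?_, by simp, by simp, ?_⟩
    · simp
    · intro g hg h hh hne
      simp at hg hh
      exact absurd (hg.trans hh.symm) hne
  | succ l ih =>
    obtain ⟨S, hS, hcard, hc, hsep⟩ := ih
    have key : ∀ u ∈ U, ∀ s ∈ S, ∀ u' ∈ U, ∀ s' ∈ S, (u, s) ≠ (u', s') →
        ∀ t ∈ Icc (0 : ℝ) 1, ∀ t' ∈ Icc (0 : ℝ) 1,
        1 / (D : ℝ) ^ (2 * (l + 1)) ≤ |(u * s).f t - (u' * s').f t'| := by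
      intro u hu s hs u' hu' s' hs' hne t ht t' ht'
      rw [u.f_mul s ht.1, u'.f_mul s' ht'.1]
      by_cases huu : u = u'
      · subst huu
        have hss : s ≠ s' := fun h => hne (by rw [h])
        have h1 := hsep s hs s' hs' hss t ht t' ht'
        have h2 := u.le_abs_f_sub (s.f_mem ht) (s'.f_mem ht')
        refine le_trans ?_ h2
        have h3 : 4 * (u.c : ℝ) ^ 2 ≤ (D : ℝ) ^ 2 := by
          have := hU.le_D u hu
          have := u.c_pos
          nlinarith
        have := u.c_pos
        calc 1 / (D : ℝ) ^ (2 * (l + 1)) = (1 / (D : ℝ) ^ (2 * l)) / (D : ℝ) ^ 2 := by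
              rw [div_div, ← pow_add]; ring_nf
          _ ≤ _ := by gcongr
      · refine le_trans ?_ (hU.sep u hu u' hu' huu _ (s.f_mem ht) _ (s'.f_mem ht'))
        apply one_div_le_one_div_of_le (by positivity)
        exact pow_le_pow_right₀ hU.one_le_D (by omega)
    have hinj : Set.InjOn (fun p : Mob × Mob => p.1 * p.2) (U ×ˢ S : Finset (Mob × Mob)) := by
      rintro ⟨u, s⟩ hp ⟨u', s'⟩ hp' heq
      simp only [Finset.coe_product, Set.mem_prod, Finset.mem_coe] at hp hp'
      by_contra hne
      have h1 := key u hp.1 s hp.2 u' hp'.1 s' hp'.2 hne 0 (by simp) 0 (by simp)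
      have heq' : u * s = u' * s' := heq
      rw [heq', sub_self, abs_zero] at h1
      have : 0 < 1 / (D : ℝ) ^ (2 * (l + 1)) := by positivity
      linarith
    refine ⟨(U ×ˢ S).image (fun p => p.1 * p.2), ?_, ?_, ?_, ?_⟩
    · intro g hg
      obtain ⟨⟨u, s⟩, hp, rfl⟩ := Finset.mem_image.1 hg
      rw [Finset.mem_product] at hp
      exact mul_mem (Submonoid.subset_closure hp.1) (hS s hp.2)
    · rw [Finset.card_image_of_injOn hinj, Finset.card_product, hcard, pow_succ, mul_comm]
    · intro g hg
      obtain ⟨⟨u, s⟩, hp, rfl⟩ := Finset.mem_image.1 hg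
      rw [Finset.mem_product] at hp
      have h1 := u.c_mul_le s
      have h2 := hU.le_D u hp.1
      have h3 := hc s hp.2
      have h4 := s.c_pos
      calc ((u * s).c : ℝ) ≤ (2 * u.c) * s.c := by linarith
        _ ≤ D * (D : ℝ) ^ l := by gcongr
        _ = (D : ℝ) ^ (l + 1) := by rw [pow_succ, mul_comm]
    · intro g hg h hh hne t ht t' ht'
      obtain ⟨⟨u, s⟩, hp, rfl⟩ := Finset.mem_image.1 hg
      obtain ⟨⟨u', s'⟩, hp', rfl⟩ := Finset.mem_image.1 hh
      rw [Finset.mem_product] at hp hp'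
      exact key u hp.1 s hp.2 u' hp'.1 s' hp'.2 (fun h => hne (by
        rw [Prod.mk.injEq] at h; simp [h.1, h.2])) t ht t' ht'

lemma exists_extend (hU : Adm U D) (u : Mob) {Y : ℝ} (hY : (u.c : ℝ) ≤ Y) :
    ∃ e ∈ cl U, Y ≤ ((u * e).c : ℝ) ∧ ((u * e).c : ℝ) ≤ D * Y := by
  obtain ⟨x, hx⟩ := hU.nonempty
  have hxc := hU.two_le x hx
  have hgrow : ∀ k : ℕ, (2 : ℝ) ^ k ≤ ((u * x ^ k).c : ℝ) := by
    intro k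
    induction k with
    | zero => simpa using u.c_ge
    | succ k ih =>
      rw [pow_succ x, ← mul_assoc]
      have := (u * x ^ k).le_c_mul x
      have := (u * x ^ k).c_pos
      rw [pow_succ]
      nlinarith
  have hex : ∃ k : ℕ, Y ≤ ((u * x ^ k).c : ℝ) := by
    obtain ⟨k, hk⟩ := pow_unbounded_of_one_lt Y (one_lt_two)
    exact ⟨k, hk.le.trans (hgrow k)⟩
  classical
  have hY0 : 0 < Y := lt_of_lt_of_le u.c_pos hY
  refine ⟨x ^ Nat.find hex, pow_mem (Submonoid.subset_closure hx) _, Nat.find_spec hex, ?_⟩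
  rcases h : Nat.find hex with _ | k
  · simp only [pow_zero, mul_one]
    nlinarith [hU.one_le_D]
  · have h1 : ¬ Y ≤ ((u * x ^ k).c : ℝ) := Nat.find_min hex (by omega)
    push Not at h1
    rw [pow_succ x, ← mul_assoc]
    have h2 := (u * x ^ k).c_mul_le x
    have h3 := hU.le_D x hx
    have h4 := (u * x ^ k).c_pos
    nlinarith

lemma exists_prefix (hU : Adm U D) {W : Mob} (hW : W ∈ cl U) {Y : ℝ} (h1 : 1 ≤ Y)
    (hY : Y ≤ W.c) : ∃ P ∈ cl U, ∃ S ∈ cl U, W = P * S ∧ Y ≤ P.c ∧ (P.c : ℝ) ≤ D * Y := by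
  have hD := hU.one_le_D
  induction hW using Submonoid.closure_induction_right with
  | one =>
    refine ⟨1, one_mem _, 1, one_mem _, by simp, hY, ?_⟩
    simp only [Mob.one_c, Int.cast_one]
    nlinarith
  | mul_right W hW x hx ih =>
    by_cases h : Y ≤ W.c
    · obtain ⟨P, hP, S, hS, rfl, h2, h3⟩ := ih h
      exact ⟨P, hP, S * x, mul_mem hS (Submonoid.subset_closure hx), mul_assoc _ _ _, h2, h3⟩
    · push Not at h
      refine ⟨W * x, mul_mem hW (Submonoid.subset_closure hx), 1, one_mem _, by simp, hY, ?_⟩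
      have h2 := W.c_mul_le x
      have h3 := hU.le_D x hx
      have h4 := W.c_pos
      nlinarith

lemma exists_suffix (hU : Adm U D) {W : Mob} (hW : W ∈ cl U) {Y : ℝ} (h1 : 1 ≤ Y)
    (hY : Y ≤ W.c) : ∃ P ∈ cl U, ∃ S ∈ cl U, W = P * S ∧ Y ≤ S.c ∧ (S.c : ℝ) ≤ D * Y := by
  have hD := hU.one_le_D
  induction hW using Submonoid.closure_induction_left with
  | one =>
    refine ⟨1, one_mem _, 1, one_mem _, by simp, hY, ?_⟩
    simp only [Mob.one_c, Int.cast_one]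
    nlinarith
  | mul_left x hx W hW ih =>
    by_cases h : Y ≤ W.c
    · obtain ⟨P, hP, S, hS, rfl, h2, h3⟩ := ih h
      exact ⟨x * P, mul_mem (Submonoid.subset_closure hx) hP, S, hS, (mul_assoc _ _ _).symm,
        h2, h3⟩
    · push Not at h
      refine ⟨1, one_mem _, x * W, mul_mem (Submonoid.subset_closure hx) hW, by simp, hY, ?_⟩
      have h2 := x.c_mul_le W
      have h3 := hU.le_D x hx
      have h4 := W.c_pos
      nlinarith

lemma abs_linear_form_ge (hU : Adm U D) {W : Mob} (hW : W ∈ cl U) {Y : ℝ} (h1 : 1 ≤ Y)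
    (hY : 2 * Y ≤ W.c) {x y : ℤ} (hxy : ¬ (x = 0 ∧ y = 0)) (hy : |(y : ℝ)| ≤ Y) :
    (W.c : ℝ) / (8 * D * Y) ≤ |x * (W.c : ℝ) + y * W.d| := by
  obtain ⟨P, hP, S, hS, rfl, h2, h3⟩ := hU.exists_suffix hW (by linarith) hY
  have hSc := S.c_pos
  have hPc := P.c_pos
  have hD := hU.D_pos
  have hm : x * S.c + y * S.d ≠ 0 := by
    intro hm
    have hdvd : S.c ∣ y := by
      refine ⟨y * S.b + S.a * x, ?_⟩
      linear_combination (-y) * S.det - S.a * hm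
    have hlt : |y| < S.c := by
      have : |(y : ℝ)| < S.c := by linarith
      exact_mod_cast this
    have hy0 : y = 0 := Int.eq_zero_of_abs_lt_dvd hdvd hlt
    subst hy0
    have hc0 : S.c ≠ 0 := by have := S.one_le_c; omega
    simp [hc0] at hm
    exact hxy ⟨hm, rfl⟩
  have hm1 : (1 : ℝ) ≤ |((x * S.c + y * S.d : ℤ) : ℝ)| := by
    rw [← Int.cast_abs]
    exact_mod_cast Int.one_le_abs hm
  set m : ℝ := ((x * S.c + y * S.d : ℤ) : ℝ) with hmdef
  have hval : x * ((P * S).c : ℝ) + y * ((P * S).d : ℝ) =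
      m * (P.c + P.d * (S.a / S.c)) + P.d * (y / S.c) := by
    have hdet := S.detR
    rw [hmdef]
    push_cast [Mob.mul_c, Mob.mul_d]
    field_simp
    linear_combination (P.d : ℝ) * y * hdet
  have hpos : (P.c : ℝ) ≤ P.c + P.d * (S.a / S.c) :=
    le_add_of_nonneg_right (mul_nonneg P.d_ge (div_nonneg S.a_ge hSc.le))
  have h5 : |(P.d : ℝ) * (y / S.c)| ≤ P.c / 2 := by
    rw [abs_mul, abs_of_nonneg P.d_ge, abs_div, abs_of_pos hSc]
    have : |(y : ℝ)| / S.c ≤ 1 / 2 := by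
      rw [div_le_div_iff₀ hSc two_pos]; linarith
    calc (P.d : ℝ) * (|(y : ℝ)| / S.c) ≤ P.c * (1 / 2) :=
          mul_le_mul P.d_le this (by positivity) hPc.le
      _ = P.c / 2 := by ring
  have h6 : (P.c : ℝ) ≤ |m * (P.c + P.d * (S.a / S.c))| := by
    rw [abs_mul, abs_of_pos (lt_of_lt_of_le hPc hpos)]
    nlinarith
  rw [hval]
  have h7 := abs_sub_abs_le_abs_sub (m * (P.c + P.d * (S.a / S.c))) (-(P.d * (y / S.c) : ℝ))
  rw [abs_neg, sub_neg_eq_add] at h7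
  have h8 : ((P * S).c : ℝ) / (8 * D * Y) ≤ P.c / 2 := by
    rw [div_le_div_iff₀ (by positivity) two_pos]
    have := P.c_mul_le S
    nlinarith
  linarith

lemma mem_bad (hU : Adm U D) {β : ℝ}
    (hβ : ∀ M : ℝ, ∃ W ∈ cl U, M ≤ W.c ∧ ∃ t ∈ Icc (0 : ℝ) 1, β = W.f t) : β ∈ Bad := by
  have hD := hU.D_pos
  refine ⟨1 / (4 * D), by positivity, fun l hl => ?_⟩
  have hl' : (1 : ℝ) ≤ l := by exact_mod_cast hl
  obtain ⟨W, hW, hWc, t, ht, rfl⟩ := hβ (2 * l)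
  obtain ⟨P, hP, S, hS, rfl, h2, h3⟩ := hU.exists_prefix hW (by linarith) hWc
  have hPc := P.c_pos
  rw [P.f_mul S ht.1]
  have hs := S.f_mem ht
  set s := S.f t
  have hclose : |P.f s - P.a / P.c| ≤ 1 / (P.c : ℝ) ^ 2 := by
    rw [← P.f_zero]
    refine (P.abs_f_sub_le hs.1 le_rfl).trans ?_
    gcongr
    rw [sub_zero, abs_of_nonneg hs.1]
    exact hs.2
  have hkey : 1 / (4 * D * l) ≤ nint (l * P.f s) := by
    refine le_ciInf fun m => ?_
    have hne : (l : ℤ) * P.a - m * P.c ≠ 0 := by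
      intro h0
      have hdvd : P.c ∣ (l : ℤ) := by
        refine ⟨P.b * l - m * P.d, ?_⟩
        linear_combination (-(l : ℤ)) * P.det - P.d * h0
      have hlt : |(l : ℤ)| < P.c := by
        rw [Nat.abs_cast]
        have : ((l : ℤ) : ℝ) < P.c := by push_cast; linarith
        exact_mod_cast this
      have := Int.eq_zero_of_abs_lt_dvd hdvd hlt
      omega
    have h1 : (1 : ℝ) ≤ |(l : ℝ) * P.a - m * P.c| := by
      have := Int.one_le_abs hne
      exact_mod_cast this
    have h4 : 1 / (P.c : ℝ) ≤ |(l : ℝ) * (P.a / P.c) - m| := by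
      have : (l : ℝ) * (P.a / P.c) - m = (l * P.a - m * P.c) / P.c := by field_simp
      rw [this, abs_div, abs_of_pos hPc]
      gcongr
    have h5 : |(l : ℝ) * (P.f s - P.a / P.c)| ≤ 1 / (2 * P.c) := by
      rw [abs_mul, abs_of_pos (by linarith : (0 : ℝ) < l)]
      calc (l : ℝ) * |P.f s - P.a / P.c| ≤ (P.c / 2) * (1 / (P.c : ℝ) ^ 2) := by
            gcongr; linarith
        _ = 1 / (2 * P.c) := by field_simp
    have h6 := abs_sub_abs_le_abs_sub ((l : ℝ) * (P.a / P.c) - m)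
      (-((l : ℝ) * (P.f s - P.a / P.c)))
    rw [abs_neg] at h6
    have h7 : (l : ℝ) * (P.a / P.c) - m - -((l : ℝ) * (P.f s - P.a / P.c)) =
      l * P.f s - m := by ring
    rw [h7] at h6
    have h8 : 1 / (P.c : ℝ) = 1 / (2 * P.c) + 1 / (2 * P.c) := by field_simp; ring
    have h9 : 1 / (4 * D * (l : ℝ)) ≤ 1 / (2 * P.c) := by
      apply one_div_le_one_div_of_le (by positivity)
      linarith
    linarith
  calc 1 / (4 * D : ℝ) = l * (1 / (4 * D * l)) := by field_simp
    _ ≤ _ := by gcongr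

end Adm

lemma card_filter_dvd_Ioc_le (N : ℕ) {k : ℕ} (hk : 0 < k) :
    (((Finset.Ioc N (2 * N)).filter (k ∣ ·)).card : ℝ) ≤ N / k + 1 := by
  have h1 := Nat.Ioc_filter_dvd_card_eq_div (2 * N) k
  have h2 := Nat.Ioc_filter_dvd_card_eq_div N k
  have h3 : (Finset.Ioc 0 (2 * N)).filter (k ∣ ·) =
      (Finset.Ioc 0 N).filter (k ∣ ·) ∪ (Finset.Ioc N (2 * N)).filter (k ∣ ·) := by
    rw [← Finset.filter_union, Finset.Ioc_union_Ioc_eq_Ioc (by omega) (by omega)]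
  have h4 : Disjoint ((Finset.Ioc 0 N).filter (k ∣ ·)) ((Finset.Ioc N (2 * N)).filter (k ∣ ·)) := by
    apply Finset.disjoint_filter_filter
    rw [Finset.disjoint_left]
    intro x; simp; omega
  have h5 := Finset.card_union_of_disjoint h4
  rw [← h3, h1, h2] at h5
  have h6 : ((2 * N / k : ℕ) : ℝ) ≤ (2 * N : ℝ) / k := by
    have := @Nat.cast_div_le ℝ _ _ _ (2 * N) k
    push_cast at this; exact this
  have h7 : (N : ℝ) / k ≤ ((N / k : ℕ) : ℝ) + 1 := by
    have hk' : (0 : ℝ) < k := by exact_mod_cast hk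
    rw [div_le_iff₀ hk']
    have := Nat.lt_div_mul_add hk (a := N)
    have h8 : (N : ℝ) ≤ ((N / k * k + k : ℕ) : ℝ) := by exact_mod_cast this.le
    push_cast at h8
    linarith
  have h5' : ((2 * N / k : ℕ) : ℝ) = ((N / k : ℕ) : ℝ) +
    (((Finset.Ioc N (2 * N)).filter (k ∣ ·)).card : ℝ) := by exact_mod_cast h5
  have h9 : (2 * N : ℝ) / k = N / k + N / k := by ring
  linarith

lemma sum_inv_sq_le {n : ℕ} (hn : 2 ≤ n) :
    ∑ k ∈ Finset.Icc 2 n, (1 : ℝ) / (k : ℝ) ^ 2 ≤ 3 / 4 - 1 / n := by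
  induction n, hn using Nat.le_induction with
  | base => norm_num
  | succ n hn ih =>
    rw [Finset.sum_Icc_succ_top (by omega)]
    have hn0 : (0 : ℝ) < n := by exact_mod_cast (by omega : 0 < n)
    have : (1 : ℝ) / ((n + 1 : ℕ) : ℝ) ^ 2 ≤ 1 / n - 1 / ((n + 1 : ℕ) : ℝ) := by
      push_cast
      rw [div_sub_div _ _ hn0.ne' (by positivity), div_le_div_iff₀ (by positivity) (by positivity)]
      nlinarith
    linarith

lemma card_coprime_ge {N : ℕ} (hN : 400 ≤ N) : (N : ℝ) ^ 2 / 8 ≤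
    (((Finset.Ioc N (2 * N)) ×ˢ (Finset.Icc 1 N)).filter
      (fun p : ℕ × ℕ => Nat.Coprime p.1 p.2)).card := by
  classical
  set B := (Finset.Ioc N (2 * N)) ×ˢ (Finset.Icc 1 N) with hB
  have hBc : B.card = N * N := by
    rw [hB, Finset.card_product]; simp; left; omega
  have hsplit := Finset.card_filter_add_card_filter_not (s := B)
    (fun p : ℕ × ℕ => Nat.Coprime p.1 p.2)
  have hsub : B.filter (fun p : ℕ × ℕ => ¬ Nat.Coprime p.1 p.2) ⊆
      (Finset.Icc 2 N).biUnion (fun k => ((Finset.Ioc N (2 * N)).filter (k ∣ ·)) ×ˢ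
        ((Finset.Ioc 0 N).filter (k ∣ ·))) := by
    rintro ⟨x, y⟩ hp
    simp only [hB, Finset.mem_filter, Finset.mem_product, Finset.mem_Ioc, Finset.mem_Icc] at hp
    obtain ⟨⟨hx, hy⟩, hxy⟩ := hp
    rw [Finset.mem_biUnion]
    have hpos : 0 < Nat.gcd x y := Nat.gcd_pos_of_pos_right _ (by omega)
    have hle : Nat.gcd x y ≤ y := Nat.gcd_le_right _ (by omega)
    refine ⟨Nat.gcd x y, ?_, ?_⟩
    · rw [Finset.mem_Icc]
      have : Nat.gcd x y ≠ 1 := hxy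
      omega
    · simp only [Finset.mem_product, Finset.mem_filter, Finset.mem_Ioc]
      exact ⟨⟨hx, Nat.gcd_dvd_left _ _⟩, ⟨by omega, hy.2⟩, Nat.gcd_dvd_right _ _⟩
  have hcard := (Finset.card_le_card hsub).trans Finset.card_biUnion_le
  have hN0 : (0 : ℝ) < N := by exact_mod_cast (by omega : 0 < N)
  have hterm : ∀ k ∈ Finset.Icc 2 N, (((((Finset.Ioc N (2 * N)).filter (k ∣ ·)) ×ˢ
        ((Finset.Ioc 0 N).filter (k ∣ ·))).card : ℕ) : ℝ) ≤
        (N : ℝ) ^ 2 * (1 / (k : ℝ) ^ 2) + N * (k : ℝ)⁻¹ := by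
    intro k hk
    rw [Finset.mem_Icc] at hk
    have hk0 : 0 < k := by omega
    rw [Finset.card_product, Nat.Ioc_filter_dvd_card_eq_div, Nat.cast_mul]
    have h1 := card_filter_dvd_Ioc_le N hk0
    have h2 := @Nat.cast_div_le ℝ _ _ _ N k
    have hk' : (0 : ℝ) < k := by exact_mod_cast hk0
    calc _ ≤ ((N : ℝ) / k + 1) * (N / k) := by gcongr
      _ = _ := by field_simp
  have hharm : ∑ k ∈ Finset.Icc 2 N, (k : ℝ)⁻¹ ≤ Real.log N := by
    have h1 := harmonic_le_one_add_log N
    rw [harmonic_eq_sum_Icc, ← Finset.add_sum_Ioc_eq_sum_Icc (by omega)] at h1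
    push_cast at h1
    have h2 : Finset.Ioc 1 N = Finset.Icc 2 N := by ext; simp; omega
    rw [h2] at h1
    norm_num at h1
    exact h1
  have hlog : Real.log N ≤ 2 * √N := by
    have h1 := Real.log_le_sub_one_of_pos (Real.sqrt_pos.2 hN0)
    rw [Real.log_sqrt hN0.le] at h1
    linarith
  have hsq : (20 : ℝ) ≤ √N := by
    apply Real.le_sqrt_of_sq_le
    have : (400 : ℝ) ≤ N := by exact_mod_cast hN
    linarith
  have hbad : ((B.filter (fun p : ℕ × ℕ => ¬ Nat.Coprime p.1 p.2)).card : ℝ) ≤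
      (N : ℝ) ^ 2 * (3 / 4) + N * (2 * √N) := by
    calc _ ≤ ∑ k ∈ Finset.Icc 2 N, (((((Finset.Ioc N (2 * N)).filter (k ∣ ·)) ×ˢ
        ((Finset.Ioc 0 N).filter (k ∣ ·))).card : ℕ) : ℝ) := by exact_mod_cast hcard
      _ ≤ ∑ k ∈ Finset.Icc 2 N, ((N : ℝ) ^ 2 * (1 / (k : ℝ) ^ 2) + N * (k : ℝ)⁻¹) :=
        Finset.sum_le_sum hterm
      _ = (N : ℝ) ^ 2 * ∑ k ∈ Finset.Icc 2 N, (1 / (k : ℝ) ^ 2) +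
          N * ∑ k ∈ Finset.Icc 2 N, (k : ℝ)⁻¹ := by
        rw [Finset.sum_add_distrib, Finset.mul_sum, Finset.mul_sum]
      _ ≤ _ := by
        gcongr
        · have := sum_inv_sq_le (n := N) (by omega)
          have : 0 < 1 / (N : ℝ) := by positivity
          linarith
        · linarith
  have hsum : ((B.filter (fun p : ℕ × ℕ => Nat.Coprime p.1 p.2)).card : ℝ) +
      ((B.filter (fun p : ℕ × ℕ => ¬ Nat.Coprime p.1 p.2)).card : ℝ) = N * N := by
    rw [hBc] at hsplit
    exact_mod_cast hsplit
  have hNs : (N : ℝ) = √N * √N := (Real.mul_self_sqrt hN0.le).symm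
  have : 2 * √N ≤ N / 8 := by nlinarith
  nlinarith

lemma exists_mob {c d : ℕ} (hd : 1 ≤ d) (hdc : d < c) (hcop : Nat.Coprime c d) :
    ∃ g : Mob, g.c = c ∧ g.d = d := by
  obtain ⟨m, hm, hmod⟩ := Nat.exists_mul_mod_eq_one_of_coprime hcop.symm (by omega)
  have hm0 : 1 ≤ m := by
    rcases Nat.eq_zero_or_pos m with rfl | h
    · simp at hmod
    · exact h
  have hdiv := Nat.div_add_mod (d * m) c
  rw [hmod] at hdiv
  set q := d * m / c
  have hz : (c : ℤ) * q + 1 = d * m := by exact_mod_cast hdiv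
  have hc' : (1 : ℤ) < c := by exact_mod_cast (by omega : 1 < c)
  have hd' : (1 : ℤ) ≤ d := by exact_mod_cast hd
  have hdc' : (d : ℤ) + 1 ≤ c := by exact_mod_cast hdc
  have hm' : (m : ℤ) + 1 ≤ c := by exact_mod_cast hm
  have hm0' : (1 : ℤ) ≤ m := by exact_mod_cast hm0
  have hdet : ((d : ℤ) - q) * c - (c - m) * d = 1 := by linear_combination (-1 : ℤ) * hz
  have hbd : (0 : ℤ) ≤ d - q := by
    by_contra h
    push Not at h
    nlinarith
  have hba : (d : ℤ) - q ≤ c - m := by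
    by_contra h
    push Not at h
    nlinarith
  have hq : (0 : ℤ) ≤ q := by positivity
  exact ⟨⟨c - m, d - q, c, d, by omega, hbd, by omega, by omega, hdet, by omega, by omega,
    by omega, by omega⟩, rfl, rfl⟩

namespace Mob

/-- The map `t ↦ (1 + t) / (2 + t)`, which moves `[0, 1]` into its interior. -/
def half : Mob := ⟨1, 1, 2, 1, by norm_num, by norm_num, by norm_num, by norm_num,
  by norm_num, by norm_num, by norm_num, by norm_num, by norm_num⟩

lemma half_f_le {t : ℝ} (ht : t ∈ Icc (0 : ℝ) 1) : half.f t ≤ 2 / 3 := by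
  have : (0 : ℝ) < 2 + t := by linarith [ht.1]
  simp only [half, f, Int.cast_one, Int.cast_ofNat, one_mul]
  rw [div_le_div_iff₀ this (by norm_num)]
  linarith [ht.2]

lemma f_mono (g : Mob) {x y : ℝ} (hx : 0 ≤ x) (hxy : x ≤ y) : g.f x ≤ g.f y := by
  have hy := hx.trans hxy
  rw [← sub_nonneg, g.f_sub hy hx]
  exact div_nonneg (sub_nonneg.2 hxy) (mul_pos (g.den_pos hy) (g.den_pos hx)).le

lemma f_one_le_f_zero {g h : Mob} (hc : h.c < 2 * g.c + g.d) (hlt : g.a * h.c < h.a * g.c) :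
    g.f 1 ≤ h.f 0 := by
  have hcd : (0 : ℝ) < g.c + g.d * 1 := g.den_pos zero_le_one
  rw [h.f_zero, f, div_le_div_iff₀ hcd h.c_pos]
  suffices (g.a + g.b) * h.c ≤ h.a * (g.c + g.d) by
    rw [mul_one, mul_one]
    exact_mod_cast this
  by_contra hcon
  push Not at hcon
  have h1 : h.c = g.c * ((h.a * g.c - g.a * h.c) + ((g.a + g.b) * h.c - h.a * (g.c + g.d))) +
      g.d * (h.a * g.c - g.a * h.c) := by
    linear_combination (-h.c) * g.det
  have h2 := g.one_le_c
  have h3 := g.d_nonneg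
  nlinarith

lemma eq_of_a_mul_eq {g h : Mob} (heq : g.a * h.c = h.a * g.c)
    (hg0 : 1 ≤ g.d) (hh0 : 1 ≤ h.d) (hg : g.d < g.c) (hh : h.d < h.c) : g.c = h.c ∧ g.d = h.d := by
  have hdvd : g.c ∣ h.c := by
    refine ⟨g.b * h.c - g.d * h.a, ?_⟩
    linear_combination (-h.c) * g.det - g.d * heq
  have hdvd' : h.c ∣ g.c := by
    refine ⟨h.b * g.c - h.d * g.a, ?_⟩
    linear_combination (-g.c) * h.det + h.d * heq
  have hg1 := g.one_le_c
  have hh1 := h.one_le_c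
  have hc : g.c = h.c := Int.dvd_antisymm (by omega) (by omega) hdvd hdvd'
  refine ⟨hc, ?_⟩
  have ha : g.a = h.a := by
    rw [hc] at heq
    exact mul_right_cancel₀ (by omega) heq
  have hd : g.c ∣ g.d - h.d := by
    have h1 := h.det
    rw [← hc, ← ha] at h1
    refine ⟨(g.d - h.d) * g.b - g.d * (g.b - h.b), ?_⟩
    linear_combination (g.d - h.d) * (-1) * g.det + g.d * (g.det - h1)
  have := Int.eq_zero_of_abs_lt_dvd hd (by rw [abs_lt]; omega)
  omega

lemma half_sep_of_lt {g h : Mob} {N : ℕ} (hN : 1 ≤ N) (hgc : (g.c : ℝ) ≤ 2 * N)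
    (hgd : (g.d : ℝ) ≤ N)
    (hc : h.c < 2 * g.c + g.d) (hlt : g.a * h.c < h.a * g.c)
    {t t' : ℝ} (ht : t ∈ Icc (0 : ℝ) 1) (ht' : t' ∈ Icc (0 : ℝ) 1) :
    1 / ((12 * N : ℕ) : ℝ) ^ 2 ≤ |(g * half).f t - (h * half).f t'| := by
  have hN' : (1 : ℝ) ≤ N := by exact_mod_cast hN
  rw [g.f_mul _ ht.1, h.f_mul _ ht'.1]
  have h1 := half_f_le ht
  have h0 := half.f_nonneg ht.1
  have h2 := f_one_le_f_zero hc hlt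
  have h3 : h.f 0 ≤ h.f (half.f t') := h.f_mono le_rfl (half.f_nonneg ht'.1)
  have h4 := g.f_sub zero_le_one h0
  set s := half.f t
  have h5 : 1 / ((12 * N : ℕ) : ℝ) ^ 2 ≤ g.f 1 - g.f s := by
    rw [h4]
    have e1 := g.den_pos zero_le_one
    have e2 := g.den_pos h0
    have e3 : (g.c : ℝ) + g.d * 1 ≤ 3 * N := by linarith
    have e4 : (g.c : ℝ) + g.d * s ≤ 3 * N := by nlinarith [g.d_ge]
    calc 1 / ((12 * N : ℕ) : ℝ) ^ 2 ≤ (1 / 3) / ((3 * N) * (3 * N)) := by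
          push_cast
          rw [div_div, div_le_div_iff₀ (by positivity) (by positivity)]
          nlinarith
      _ ≤ _ := by
          gcongr <;> linarith
  rw [abs_sub_comm]
  exact le_trans (by linarith) (le_abs_self _)

end Mob

lemma exists_alphabet {N : ℕ} (hN : 400 ≤ N) : ∃ U : Finset Mob,
    (N : ℝ) ^ 2 / 8 ≤ U.card ∧ (∀ g ∈ U, (2 : ℝ) ≤ g.c) ∧
    (∀ g ∈ U, 2 * (g.c : ℝ) ≤ ((12 * N : ℕ) : ℝ)) ∧
    ∀ g ∈ U, ∀ h ∈ U, g ≠ h → ∀ t ∈ Icc (0 : ℝ) 1, ∀ t' ∈ Icc (0 : ℝ) 1,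
      1 / ((12 * N : ℕ) : ℝ) ^ 2 ≤ |g.f t - h.f t'| := by
  classical
  set B := ((Finset.Ioc N (2 * N)) ×ˢ (Finset.Icc 1 N)).filter
      (fun p : ℕ × ℕ => Nat.Coprime p.1 p.2) with hB
  have hBmem : ∀ p ∈ B, (N < p.1 ∧ p.1 ≤ 2 * N) ∧ (1 ≤ p.2 ∧ p.2 ≤ N) ∧ Nat.Coprime p.1 p.2 := by
    intro p hp
    simpa [hB, and_assoc] using hp
  have hex : ∀ p : ℕ × ℕ, ∃ g : Mob, p ∈ B → g.c = p.1 ∧ g.d = p.2 := by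
    intro p
    by_cases hp : p ∈ B
    · obtain ⟨h1, h2, h3⟩ := hBmem p hp
      obtain ⟨g, hg⟩ := exists_mob h2.1 (by omega) h3
      exact ⟨g, fun _ => hg⟩
    · exact ⟨1, fun h => absurd h hp⟩
  choose G hG using hex
  have hN1 : 1 ≤ N := by omega
  have hN0 : (0 : ℝ) < N := by exact_mod_cast hN1
  have hreal : ∀ p ∈ B, ((G p).c : ℝ) ≤ 2 * N ∧ ((G p).d : ℝ) ≤ N := by
    intro p hp
    obtain ⟨h1, h2, h3⟩ := hBmem p hp
    obtain ⟨e1, e2⟩ := hG p hp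
    rw [e1, e2]
    constructor
    · exact_mod_cast h1.2
    · exact_mod_cast h2.2
  have hlt : ∀ p ∈ B, ∀ p' ∈ B, (G p').c < 2 * (G p).c + (G p).d := by
    intro p hp p' hp'
    have h1 := hBmem p hp
    have h2 := hBmem p' hp'
    rw [(hG p hp).1, (hG p hp).2, (hG p' hp').1]
    norm_cast
    omega
  have key : ∀ p ∈ B, ∀ p' ∈ B, p ≠ p' → ∀ t ∈ Icc (0 : ℝ) 1, ∀ t' ∈ Icc (0 : ℝ) 1,
      1 / ((12 * N : ℕ) : ℝ) ^ 2 ≤ |(G p * Mob.half).f t - (G p' * Mob.half).f t'| := by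
    intro p hp p' hp' hne t ht t' ht'
    rcases lt_trichotomy ((G p).a * (G p').c) ((G p').a * (G p).c) with h | h | h
    · exact Mob.half_sep_of_lt hN1 (hreal p hp).1 (hreal p hp).2 (hlt p hp p' hp') h ht ht'
    · exfalso
      have h1 := hBmem p hp
      have h2 := hBmem p' hp'
      have := Mob.eq_of_a_mul_eq h
      rw [(hG p hp).1, (hG p hp).2, (hG p' hp').1, (hG p' hp').2] at this
      norm_cast at this
      have := this (by omega) (by omega) (by omega) (by omega)
      exact hne (Prod.ext this.1 this.2)
    · rw [abs_sub_comm]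
      exact Mob.half_sep_of_lt hN1 (hreal p' hp').1 (hreal p' hp').2 (hlt p' hp' p hp) h ht' ht
  have hinj : Set.InjOn (fun p => G p * Mob.half) B := by
    intro p hp p' hp' heq
    by_contra hne
    have h1 := key p hp p' hp' hne 0 (by simp) 0 (by simp)
    have heq' : G p * Mob.half = G p' * Mob.half := heq
    rw [heq', sub_self, abs_zero] at h1
    have : 0 < 1 / ((12 * N : ℕ) : ℝ) ^ 2 := by
      push_cast
      positivity
    linarith
  refine ⟨B.image (fun p => G p * Mob.half), ?_, ?_, ?_, ?_⟩
  · rw [Finset.card_image_of_injOn hinj]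
    exact card_coprime_ge hN
  · intro g hg
    obtain ⟨p, hp, rfl⟩ := Finset.mem_image.1 hg
    have h1 := (G p).le_c_mul Mob.half
    have h2 := (G p).c_ge
    have h3 : (Mob.half.c : ℝ) = 2 := by norm_num [Mob.half]
    rw [h3] at h1
    linarith
  · intro g hg
    obtain ⟨p, hp, rfl⟩ := Finset.mem_image.1 hg
    have h1 := hreal p hp
    have h3 : ((G p * Mob.half).c : ℝ) = (G p).c * 2 + (G p).d := by
      rw [Mob.mul_c]
      push_cast [Mob.half]
      ring
    rw [h3]
    push_cast
    linarith
  · intro g hg h hh hne t ht t' ht'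
    obtain ⟨p, hp, rfl⟩ := Finset.mem_image.1 hg
    obtain ⟨p', hp', rfl⟩ := Finset.mem_image.1 hh
    exact key p hp p' hp' (fun h => hne (by rw [h])) t ht t' ht'

lemma Adm.exists_adm {s : ℝ} (hs : s < 1) :
    ∃ (U : Finset Mob) (D : ℕ), Adm U D ∧ (D : ℝ) ^ (2 * s) ≤ U.card := by
  have ht : Filter.Tendsto (fun N : ℕ => ((12 * N : ℕ) : ℝ) ^ (2 - 2 * s)) Filter.atTop
      Filter.atTop := by
    refine (tendsto_rpow_atTop (by linarith)).comp ?_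
    refine tendsto_natCast_atTop_atTop.comp ?_
    exact Filter.tendsto_id.const_mul_atTop' (by norm_num)
  obtain ⟨N, hN, hN2⟩ := ((ht.eventually_ge_atTop 1152).and
    (Filter.eventually_ge_atTop (12 ^ 9 * 8 ^ 5))).exists
  obtain ⟨U, hcard, h2, h3, h4⟩ := exists_alphabet (N := N) (by omega)
  have hNR : (12 ^ 9 * 8 ^ 5 : ℝ) ≤ N := by exact_mod_cast hN2
  have hN0 : (0 : ℝ) < N := lt_of_lt_of_le (by norm_num) hNR
  refine ⟨U, 12 * N, ⟨h2, h3, h4, ?_, ?_⟩, ?_⟩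
  · calc ((12 * N : ℕ) : ℝ) ^ 9 = 12 ^ 9 * 8 ^ 5 * ((N : ℝ) ^ 9 / 8 ^ 5) := by push_cast; ring
      _ ≤ N * ((N : ℝ) ^ 9 / 8 ^ 5) := by gcongr
      _ = ((N : ℝ) ^ 2 / 8) ^ 5 := by ring
      _ ≤ _ := by gcongr
  · push_cast
    refine le_trans ?_ (mul_le_mul_of_nonneg_left hNR (by norm_num))
    norm_num
  · refine le_trans ?_ hcard
    have hD0 : (0 : ℝ) < ((12 * N : ℕ) : ℝ) := by push_cast; positivity
    have h5 : ((12 * N : ℕ) : ℝ) ^ (2 - 2 * s) * ((12 * N : ℕ) : ℝ) ^ (2 * s) =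
        ((12 * N : ℕ) : ℝ) ^ 2 := by
      rw [← Real.rpow_add hD0, ← Real.rpow_natCast]
      norm_num
    have h6 : 0 < ((12 * N : ℕ) : ℝ) ^ (2 * s) := Real.rpow_pos_of_pos hD0 _
    have h7 : ((12 * N : ℕ) : ℝ) ^ 2 = 1152 * ((N : ℝ) ^ 2 / 8) := by push_cast; ring
    nlinarith

/-- The additive character `x ↦ exp (2 π i x)`. -/
noncomputable def ee (x : ℝ) : ℂ := Complex.exp ((2 * π * x : ℝ) * Complex.I)

lemma ee_add (x y : ℝ) : ee (x + y) = ee x * ee y := by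
  rw [ee, ee, ee, ← Complex.exp_add]
  push_cast
  ring_nf

@[simp] lemma ee_zero : ee 0 = 1 := by simp [ee]

@[simp] lemma norm_ee (x : ℝ) : ‖ee x‖ = 1 := Complex.norm_exp_ofReal_mul_I _

lemma ee_intCast (z : ℤ) : ee z = 1 := by
  rw [ee, Complex.exp_eq_one_iff]
  exact ⟨z, by push_cast; ring⟩

lemma ee_sub (x y : ℝ) : ee (x - y) = ee x * (starRingEnd ℂ) (ee y) := by
  rw [sub_eq_add_neg, ee_add]
  congr 1
  rw [ee, ee, ← Complex.exp_conj]
  congr 1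
  rw [map_mul, Complex.conj_ofReal, Complex.conj_I]
  push_cast
  ring

lemma ee_nat_mul (n : ℕ) (x : ℝ) : ee (n * x) = ee x ^ n := by
  rw [ee, ee, ← Complex.exp_nat_mul]
  congr 1
  push_cast
  ring

lemma norm_ee_sub_one_ge {x : ℝ} (hx : |x| ≤ 1 / 2) : 4 * |x| ≤ ‖ee x - 1‖ := by
  have h1 : ‖ee x - 1‖ = 2 * |Real.sin (π * x)| := by
    rw [ee, mul_comm, Complex.norm_exp_I_mul_ofReal_sub_one, norm_mul, Real.norm_eq_abs,
      Real.norm_eq_abs, abs_two]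
    congr 3
    ring
  have h2 : |π * x| ≤ π / 2 := by
    rw [abs_mul, abs_of_pos Real.pi_pos]
    nlinarith [Real.pi_pos]
  have h3 := Real.mul_abs_le_abs_sin h2
  rw [abs_mul, abs_of_pos Real.pi_pos] at h3
  have h4 : 2 / π * (π * |x|) = 2 * |x| := by field_simp
  rw [h1]
  linarith

lemma norm_ee_sub_one_ge_of_dist {x η : ℝ} (hx : ∀ z : ℤ, η ≤ |x - z|) :
    4 * η ≤ ‖ee x - 1‖ := by
  have h1 : ee x = ee (x - round x) := by
    conv_lhs => rw [← sub_add_cancel x (round x : ℝ), ee_add, ee_intCast, mul_one]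
  rw [h1]
  exact le_trans (by linarith [hx (round x)]) (norm_ee_sub_one_ge (abs_sub_round x))

lemma norm_geom_ee_le (n : ℕ) {x c : ℝ} (hc : 0 < c) (h : c ≤ ‖ee x - 1‖) :
    ‖∑ i ∈ Finset.range n, ee (i * x)‖ ≤ 2 / c := by
  simp_rw [ee_nat_mul]
  have hne : ee x ≠ 1 := by
    intro h1
    rw [h1, sub_self, norm_zero] at h
    linarith
  rw [geom_sum_eq hne, norm_div]
  have : ‖ee x ^ n - 1‖ ≤ 2 := by
    refine (norm_sub_le _ _).trans ?_
    rw [norm_pow, norm_ee]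
    norm_num
  gcongr

lemma sq_norm_sum_ee {ι : Type*} (s : Finset ι) (y : ι → ℝ) :
    ((‖∑ a ∈ s, ee (y a)‖ ^ 2 : ℝ) : ℂ) = ∑ a ∈ s, ∑ b ∈ s, ee (y a - y b) := by
  rw [← Complex.normSq_eq_norm_sq, ← Complex.mul_conj, map_sum, Finset.sum_mul_sum]
  simp_rw [ee_sub]

lemma sum_inv_le_of_sep {ι : Type*} (P : Finset ι) (x : ι → ℝ) {ξ : ℝ} (hξ : 0 < ξ) (hξ1 : ξ ≤ 1)
    (h1 : ∀ v ∈ P, ξ ≤ x v) (h2 : ∀ v ∈ P, x v ≤ 1)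
    (hsep : ∀ v ∈ P, ∀ w ∈ P, v ≠ w → ξ ≤ |x v - x w|) :
    ∑ v ∈ P, 1 / x v ≤ 1 / ξ * (1 + Real.log (1 / ξ)) := by
  classical
  have hinj : Set.InjOn (fun v => ⌊x v / ξ⌋₊) P := by
    intro v hv w hw heq
    by_contra hne
    have h3 := hsep v hv w hw hne
    have heq' : ⌊x v / ξ⌋₊ = ⌊x w / ξ⌋₊ := heq
    have a1 := Nat.floor_le (div_nonneg (hξ.le.trans (h1 v hv)) hξ.le)
    have a2 := Nat.floor_le (div_nonneg (hξ.le.trans (h1 w hw)) hξ.le)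
    have b1 := Nat.lt_floor_add_one (x v / ξ)
    have b2 := Nat.lt_floor_add_one (x w / ξ)
    rw [heq'] at a1 b1
    have : |x v / ξ - x w / ξ| < 1 := by rw [abs_lt]; constructor <;> linarith
    rw [← sub_div, abs_div, abs_of_pos hξ, div_lt_one hξ] at this
    linarith
  have hterm : ∀ v ∈ P, 1 / x v ≤ 1 / ξ * ((⌊x v / ξ⌋₊ : ℕ) : ℝ)⁻¹ := by
    intro v hv
    have a1 := Nat.floor_le (div_nonneg (hξ.le.trans (h1 v hv)) hξ.le)
    have a2 : (1 : ℝ) ≤ (⌊x v / ξ⌋₊ : ℕ) := by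
      have : 1 ≤ ⌊x v / ξ⌋₊ := by
        rw [Nat.one_le_floor_iff, le_div_iff₀ hξ]
        linarith [h1 v hv]
      exact_mod_cast this
    rw [le_div_iff₀ hξ] at a1
    rw [one_div, one_div, ← mul_inv]
    apply inv_anti₀ (by positivity)
    linarith
  have hharm := harmonic_floor_le_one_add_log (1 / ξ) (by rwa [le_div_iff₀ hξ, one_mul])
  rw [harmonic_eq_sum_Icc] at hharm
  push_cast at hharm
  calc ∑ v ∈ P, 1 / x v ≤ ∑ v ∈ P, 1 / ξ * ((⌊x v / ξ⌋₊ : ℕ) : ℝ)⁻¹ := Finset.sum_le_sum hterm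
    _ = 1 / ξ * ∑ k ∈ P.image (fun v => ⌊x v / ξ⌋₊), (k : ℝ)⁻¹ := by
      rw [Finset.sum_image hinj, Finset.mul_sum]
    _ ≤ 1 / ξ * ∑ k ∈ Finset.Icc 1 ⌊1 / ξ⌋₊, (k : ℝ)⁻¹ := by
      gcongr
      intro k hk
      obtain ⟨v, hv, rfl⟩ := Finset.mem_image.1 hk
      rw [Finset.mem_Icc]
      constructor
      · rw [Nat.one_le_floor_iff, le_div_iff₀ hξ]
        linarith [h1 v hv]
      · apply Nat.floor_le_floor
        have := h2 v hv
        gcongr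
    _ ≤ _ := by gcongr

lemma large_sieve {κ : Type*} (V : Finset κ) (g : κ → ℝ) {ξ τ θ : ℝ} (hξ : 0 < ξ) (hξ1 : ξ ≤ 1)
    (hg : ∀ v ∈ V, g v ∈ Icc (0 : ℝ) 1)
    (hsep : ∀ v ∈ V, ∀ w ∈ V, v ≠ w → ξ ≤ |g v - g w|)
    (hτ : 0 < τ) (hθ : τ ≤ |θ|) (hθ1 : |θ| ≤ 1 / 2) (n : ℕ) :
    ∑ i ∈ Finset.range n, ‖∑ v ∈ V, ee (i * (θ * g v))‖ ^ 2 ≤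
      V.card * (n + 1 / (τ * ξ) * (1 + Real.log (1 / ξ))) := by
  classical
  have h1 : ((∑ i ∈ Finset.range n, ‖∑ v ∈ V, ee (i * (θ * g v))‖ ^ 2 : ℝ) : ℂ) =
      ∑ v ∈ V, ∑ w ∈ V, ∑ i ∈ Finset.range n, ee (i * (θ * (g v - g w))) := by
    rw [Complex.ofReal_sum]
    simp_rw [sq_norm_sum_ee]
    rw [Finset.sum_comm]
    refine Finset.sum_congr rfl fun v _ => ?_
    rw [Finset.sum_comm]
    refine Finset.sum_congr rfl fun w _ => Finset.sum_congr rfl fun i _ => ?_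
    congr 1
    ring
  have hrow : ∀ v ∈ V, ∑ w ∈ V, ‖∑ i ∈ Finset.range n, ee (i * (θ * (g v - g w)))‖ ≤
      n + 1 / (τ * ξ) * (1 + Real.log (1 / ξ)) := by
    intro v hv
    have hoff : ∀ w ∈ V.erase v, ‖∑ i ∈ Finset.range n, ee (i * (θ * (g v - g w)))‖ ≤
        1 / (2 * τ) * (1 / |g v - g w|) := by
      intro w hw
      rw [Finset.mem_erase] at hw
      have hd : 0 < |g v - g w| := lt_of_lt_of_le hξ (hsep v hv w hw.2 hw.1.symm)
      have hd1 : |g v - g w| ≤ 1 := by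
        have a := hg v hv
        have b := hg w hw.2
        rw [abs_le]; constructor <;> linarith [a.1, a.2, b.1, b.2]
      have hx : |θ * (g v - g w)| ≤ 1 / 2 := by
        rw [abs_mul]
        nlinarith
      have h3 := norm_ee_sub_one_ge hx
      rw [abs_mul] at h3
      have h4 : 4 * (τ * |g v - g w|) ≤ ‖ee (θ * (g v - g w)) - 1‖ := by
        refine le_trans ?_ h3
        gcongr
      refine (norm_geom_ee_le n (by positivity) h4).trans (le_of_eq ?_)
      field_simp
      norm_num
    rw [← Finset.add_sum_erase _ _ hv]
    have hdiag : ‖∑ i ∈ Finset.range n, ee (i * (θ * (g v - g v)))‖ ≤ n := by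
      simp
    have hposneg : ∑ w ∈ V.erase v, 1 / |g v - g w| ≤ 2 * (1 / ξ * (1 + Real.log (1 / ξ))) := by
      rw [← Finset.sum_filter_add_sum_filter_not _ (fun w => g v ≤ g w)]
      have hp : ∑ w ∈ (V.erase v).filter (fun w => g v ≤ g w), 1 / |g v - g w| ≤
          1 / ξ * (1 + Real.log (1 / ξ)) := by
        apply sum_inv_le_of_sep _ _ hξ hξ1
        · intro w hw
          rw [Finset.mem_filter, Finset.mem_erase] at hw
          exact hsep v hv w hw.1.2 hw.1.1.symm
        · intro w hw
          rw [Finset.mem_filter, Finset.mem_erase] at hw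
          have a := hg v hv
          have b := hg w hw.1.2
          rw [abs_le]; constructor <;> linarith [a.1, a.2, b.1, b.2]
        · intro w hw w' hw' hne
          rw [Finset.mem_filter, Finset.mem_erase] at hw hw'
          rw [abs_of_nonpos (sub_nonpos.2 hw.2), abs_of_nonpos (sub_nonpos.2 hw'.2)]
          have := hsep w hw.1.2 w' hw'.1.2 hne
          convert this using 2
          ring
      have hq : ∑ w ∈ (V.erase v).filter (fun w => ¬ g v ≤ g w), 1 / |g v - g w| ≤
          1 / ξ * (1 + Real.log (1 / ξ)) := by
        apply sum_inv_le_of_sep _ _ hξ hξ1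
        · intro w hw
          rw [Finset.mem_filter, Finset.mem_erase] at hw
          exact hsep v hv w hw.1.2 hw.1.1.symm
        · intro w hw
          rw [Finset.mem_filter, Finset.mem_erase] at hw
          have a := hg v hv
          have b := hg w hw.1.2
          rw [abs_le]; constructor <;> linarith [a.1, a.2, b.1, b.2]
        · intro w hw w' hw' hne
          rw [Finset.mem_filter, Finset.mem_erase] at hw hw'
          rw [abs_of_pos (sub_pos.2 (not_le.1 hw.2)), abs_of_pos (sub_pos.2 (not_le.1 hw'.2))]
          have := hsep w' hw'.1.2 w hw.1.2 hne.symm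
          convert this using 2
          ring
      linarith
    have hsum := Finset.sum_le_sum hoff
    rw [← Finset.mul_sum] at hsum
    have h5 : 1 / (2 * τ) * ∑ w ∈ V.erase v, 1 / |g v - g w| ≤
        1 / (2 * τ) * (2 * (1 / ξ * (1 + Real.log (1 / ξ)))) := by gcongr
    have h6 : 1 / (2 * τ) * (2 * (1 / ξ * (1 + Real.log (1 / ξ)))) =
        1 / (τ * ξ) * (1 + Real.log (1 / ξ)) := by field_simp
    linarith
  have hnn : 0 ≤ ∑ i ∈ Finset.range n, ‖∑ v ∈ V, ee (i * (θ * g v))‖ ^ 2 := by positivity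
  calc ∑ i ∈ Finset.range n, ‖∑ v ∈ V, ee (i * (θ * g v))‖ ^ 2
      = ‖((∑ i ∈ Finset.range n, ‖∑ v ∈ V, ee (i * (θ * g v))‖ ^ 2 : ℝ) : ℂ)‖ := by
        rw [Complex.norm_real, Real.norm_of_nonneg hnn]
    _ = ‖∑ v ∈ V, ∑ w ∈ V, ∑ i ∈ Finset.range n, ee (i * (θ * (g v - g w)))‖ := by rw [h1]
    _ ≤ ∑ v ∈ V, ∑ w ∈ V, ‖∑ i ∈ Finset.range n, ee (i * (θ * (g v - g w)))‖ :=
        (norm_sum_le _ _).trans (Finset.sum_le_sum fun v _ => norm_sum_le _ _)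
    _ ≤ ∑ v ∈ V, (n + 1 / (τ * ξ) * (1 + Real.log (1 / ξ))) := Finset.sum_le_sum hrow
    _ = _ := by rw [Finset.sum_const, nsmul_eq_mul]

set_option maxHeartbeats 1000000 in
lemma exists_near_int {ι κ : Type*} (s : Finset ι) (V : Finset κ) (T : ι → ℝ) (g : κ → ℝ)
    (K : ι → ℝ) {A ξ : ℝ} (l : ℕ) (hA : 0 ≤ A) (hξ : 0 < ξ) (hξ1 : ξ ≤ 1)
    (hT : ∀ j ∈ s, T j ∈ Icc 0 A) (hTsep : ∀ j ∈ s, ∀ j' ∈ s, j ≠ j' → 1 ≤ |T j - T j'|)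
    (hg : ∀ v ∈ V, g v ∈ Icc (0 : ℝ) 1)
    (hsep : ∀ v ∈ V, ∀ w ∈ V, v ≠ w → ξ ≤ |g v - g w|)
    (hbig : 4 * ((4 : ℝ) ^ l) ^ 2 * (2 * 4 ^ l * A + 1 + 2 * 4 ^ l / ξ * (1 + Real.log (1 / ξ)))
      < s.card * V.card) :
    ∃ j ∈ s, ∃ v ∈ V, ∃ z : ℤ, |T j * g v - K j - z| < 2 * (1 / 2 : ℝ) ^ l := by
  classical
  by_contra hcon
  push Not at hcon
  set H : ℕ := 4 ^ l with hH
  have hHr : (H : ℝ) = 4 ^ l := by rw [hH]; push_cast; rfl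
  set η : ℝ := (1 / 2 : ℝ) ^ l with hη
  have hη0 : 0 < η := by positivity
  have hH0 : (0 : ℝ) < H := by rw [hHr]; positivity
  have hηH : η ^ 2 * H = 1 := by
    rw [hη, hHr, ← pow_mul, mul_comm l 2, pow_mul, ← mul_pow]
    norm_num
  have hη1 : η ≤ 1 := pow_le_one₀ (by norm_num) (by norm_num)
  set τ : ℝ := 1 / (2 * H) with hτ
  have hτ0 : 0 < τ := by positivity
  have hτη : τ ≤ η := by
    rw [hτ, div_le_iff₀ (by positivity)]
    nlinarith
  have hτ1 : τ < 1 := by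
    rw [hτ, div_lt_one (by positivity)]
    have : (1 : ℝ) ≤ H := by rw [hHr]; exact one_le_pow₀ (by norm_num)
    linarith
  set idx : ι → ℕ := fun j => ⌊T j / τ⌋₊ with hidx
  have hfl : ∀ j ∈ s, τ * idx j ≤ T j ∧ T j < τ * idx j + τ := by
    intro j hj
    have a1 := Nat.floor_le (div_nonneg (hT j hj).1 hτ0.le)
    have a2 := Nat.lt_floor_add_one (T j / τ)
    rw [le_div_iff₀ hτ0] at a1
    rw [div_lt_iff₀ hτ0] at a2
    constructor
    · simp only [hidx]; linarith
    · simp only [hidx]; linarith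
  have hinj : Set.InjOn idx s := by
    intro j hj j' hj' heq
    by_contra hne
    have h1 := hTsep j hj j' hj' hne
    have a1 := hfl j hj
    have a2 := hfl j' hj'
    rw [heq] at a1
    have : |T j - T j'| < 1 := by rw [abs_lt]; constructor <;> linarith
    linarith
  set n : ℕ := ⌊A / τ⌋₊ + 1 with hn
  have hidxlt : ∀ j ∈ s, idx j < n := by
    intro j hj
    have : ⌊T j / τ⌋₊ ≤ ⌊A / τ⌋₊ := by
      apply Nat.floor_le_floor
      have := (hT j hj).2
      gcongr
    simp only [hidx, hn]
    omega
  have hnr : (n : ℝ) ≤ 2 * 4 ^ l * A + 1 := by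
    have : A / τ = 2 * 4 ^ l * A := by rw [hτ, hHr]; field_simp
    rw [← this, hn]
    push_cast
    have := Nat.floor_le (div_nonneg hA hτ0.le)
    linarith
  set E : ℝ := V.card * (n + 1 / (τ * ξ) * (1 + Real.log (1 / ξ))) with hE
  set S : ℕ × ℕ → ℕ → ℝ := fun p i => ‖∑ v ∈ V, ee (i * ((((p.1 : ℝ) - p.2) * τ) * g v))‖ with hS
  set O := (Finset.range H).offDiag with hO
  have hsieve : ∀ p ∈ O, ∑ j ∈ s, S p (idx j) ^ 2 ≤ E := by
    intro p hp
    rw [hO, Finset.mem_offDiag, Finset.mem_range, Finset.mem_range] at hp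
    obtain ⟨hp1, hp2, hp3⟩ := hp
    have h1 : (1 : ℝ) ≤ |(p.1 : ℝ) - p.2| := by
      have : (p.1 : ℤ) - p.2 ≠ 0 := by omega
      have := Int.one_le_abs this
      exact_mod_cast this
    have h2 : |(p.1 : ℝ) - p.2| ≤ H := by
      have a1 : (p.1 : ℝ) < H := by exact_mod_cast hp1
      have a2 : (p.2 : ℝ) < H := by exact_mod_cast hp2
      have a3 : (0 : ℝ) ≤ p.1 := by positivity
      have a4 : (0 : ℝ) ≤ p.2 := by positivity
      rw [abs_le]; constructor <;> linarith
    have h3 := large_sieve V g hξ hξ1 hg hsep hτ0 (θ := ((p.1 : ℝ) - p.2) * τ)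
      (by rw [abs_mul, abs_of_pos hτ0]; nlinarith)
      (by
        rw [abs_mul, abs_of_pos hτ0]
        calc |(p.1 : ℝ) - p.2| * τ ≤ H * τ := by gcongr
          _ = 1 / 2 := by rw [hτ]; field_simp) n
    refine le_trans ?_ h3
    rw [← Finset.sum_image (f := fun i : ℕ => S p i ^ 2) hinj]
    refine Finset.sum_le_sum_of_subset_of_nonneg ?_ (fun _ _ _ => by positivity)
    intro i hi
    obtain ⟨j, hj, rfl⟩ := Finset.mem_image.1 hi
    exact Finset.mem_range.2 (hidxlt j hj)
  have hlow : ∀ j ∈ s, (H : ℝ) * V.card / 2 ≤ ∑ p ∈ O, S p (idx j) := by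
    intro j hj
    set x : κ → ℝ := fun v => τ * idx j * g v - K j with hx
    have hxfar : ∀ v ∈ V, ∀ z : ℤ, η ≤ |x v - z| := by
      intro v hv z
      have h1 := hcon j hj v hv z
      have h2 : |T j * g v - K j - z - (x v - z)| ≤ η := by
        have : T j * g v - K j - z - (x v - z) = (T j - τ * idx j) * g v := by
          simp only [hx]; ring
        rw [this, abs_of_nonneg (mul_nonneg (by linarith [(hfl j hj).1]) (hg v hv).1)]
        have a1 := hfl j hj
        have a2 := hg v hv
        nlinarith [a2.1, a2.2, a1.1, a1.2]
      have h3 := abs_sub_abs_le_abs_sub (T j * g v - K j - z) (x v - z)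
      linarith
    have hF : ∀ v ∈ V, ‖∑ p ∈ Finset.range H, ee (p * x v)‖ ^ 2 ≤ H / 4 := by
      intro v hv
      have h1 := norm_geom_ee_le H (by positivity) (norm_ee_sub_one_ge_of_dist (hxfar v hv))
      calc ‖∑ p ∈ Finset.range H, ee (p * x v)‖ ^ 2 ≤ (2 / (4 * η)) ^ 2 := by gcongr
        _ = (H : ℝ) / 4 := by
          field_simp
          linarith
    have hexp : ((∑ v ∈ V, ‖∑ p ∈ Finset.range H, ee (p * x v)‖ ^ 2 : ℝ) : ℂ) =
        ∑ p ∈ Finset.range H ×ˢ Finset.range H, ∑ v ∈ V, ee (((p.1 : ℝ) - p.2) * x v) := by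
      rw [Complex.ofReal_sum]
      simp_rw [sq_norm_sum_ee]
      rw [Finset.sum_product, Finset.sum_comm]
      refine Finset.sum_congr rfl fun p _ => ?_
      rw [Finset.sum_comm]
      refine Finset.sum_congr rfl fun p' _ => Finset.sum_congr rfl fun v _ => ?_
      congr 1
      ring
    have hterm : ∀ p : ℕ × ℕ, ‖∑ v ∈ V, ee (((p.1 : ℝ) - p.2) * x v)‖ = S p (idx j) := by
      intro p
      have : ∑ v ∈ V, ee (((p.1 : ℝ) - p.2) * x v) = ee (-(((p.1 : ℝ) - p.2) * K j)) *
          ∑ v ∈ V, ee (idx j * ((((p.1 : ℝ) - p.2) * τ) * g v)) := by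
        rw [Finset.mul_sum]
        refine Finset.sum_congr rfl fun v _ => ?_
        rw [← ee_add]
        congr 1
        simp only [hx]
        ring
      rw [this, norm_mul, norm_ee, one_mul]
    rw [← Finset.diag_union_offDiag, Finset.sum_union (Finset.disjoint_diag_offDiag _)] at hexp
    have hdiag : ∑ p ∈ (Finset.range H).diag, ∑ v ∈ V, ee (((p.1 : ℝ) - p.2) * x v) =
        ((H * V.card : ℝ) : ℂ) := by
      rw [Finset.sum_congr rfl (g := fun _ => (V.card : ℂ))]
      · simp
      · intro p hp
        rw [Finset.mem_diag] at hp
        rw [hp.2]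
        simp
    rw [hdiag] at hexp
    have h1 : (H * V.card : ℝ) ≤ ∑ v ∈ V, ‖∑ p ∈ Finset.range H, ee (p * x v)‖ ^ 2 +
        ∑ p ∈ O, S p (idx j) := by
      have e1 : ((H * V.card : ℝ) : ℂ) =
          ((∑ v ∈ V, ‖∑ p ∈ Finset.range H, ee (p * x v)‖ ^ 2 : ℝ) : ℂ) -
          ∑ p ∈ O, ∑ v ∈ V, ee (((p.1 : ℝ) - p.2) * x v) := by
        rw [hexp]; ring
      have e2 := congrArg norm e1
      rw [Complex.norm_real, Real.norm_of_nonneg (mul_nonneg hH0.le (Nat.cast_nonneg _))] at e2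
      rw [e2]
      refine (norm_sub_le _ _).trans ?_
      rw [Complex.norm_real, Real.norm_of_nonneg (Finset.sum_nonneg fun _ _ => sq_nonneg _)]
      gcongr
      refine (norm_sum_le _ _).trans (le_of_eq ?_)
      exact Finset.sum_congr rfl fun p _ => hterm p
    have h2 : ∑ v ∈ V, ‖∑ p ∈ Finset.range H, ee (p * x v)‖ ^ 2 ≤ V.card * (H / 4) := by
      refine (Finset.sum_le_sum hF).trans (le_of_eq ?_)
      rw [Finset.sum_const, nsmul_eq_mul]
    have h3 : (0 : ℝ) ≤ H * V.card := by positivity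
    linarith
  have hOcard : (O.card : ℝ) ≤ (H : ℝ) ^ 2 := by
    have : O.card ≤ H * H := by
      rw [hO, Finset.offDiag_card, Finset.card_range]
      exact Nat.sub_le _ _
    rw [sq]
    exact_mod_cast this
  have hE0 : 0 ≤ E := by
    have : 0 ≤ Real.log (1 / ξ) := Real.log_nonneg (by rwa [le_div_iff₀ hξ, one_mul])
    positivity
  have hCS : (∑ q ∈ s ×ˢ O, S q.2 (idx q.1)) ^ 2 ≤
      (s.card * H ^ 2) * (H ^ 2 * E) := by
    refine sq_sum_le_card_mul_sum_sq.trans ?_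
    rw [Finset.card_product, Nat.cast_mul, Finset.sum_product_right]
    have : ∑ p ∈ O, ∑ j ∈ s, S p (idx j) ^ 2 ≤ H ^ 2 * E := by
      refine (Finset.sum_le_sum hsieve).trans ?_
      rw [Finset.sum_const, nsmul_eq_mul]
      gcongr
    gcongr
  have hlow2 : s.card * (H * V.card / 2) ≤ ∑ q ∈ s ×ˢ O, S q.2 (idx q.1) := by
    rw [Finset.sum_product]
    refine le_trans (le_of_eq ?_) (Finset.sum_le_sum hlow)
    rw [Finset.sum_const, nsmul_eq_mul]
  have hsq : (s.card * (H * V.card / 2) : ℝ) ^ 2 ≤ (s.card * H ^ 2) * (H ^ 2 * E) :=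
    (pow_le_pow_left₀ (by positivity) hlow2 2).trans hCS
  have hX : (n : ℝ) + 1 / (τ * ξ) * (1 + Real.log (1 / ξ)) ≤
      2 * 4 ^ l * A + 1 + 2 * 4 ^ l / ξ * (1 + Real.log (1 / ξ)) := by
    have : 1 / (τ * ξ) = 2 * 4 ^ l / ξ := by rw [hτ, hHr]; field_simp
    rw [this]
    linarith
  set X : ℝ := (n : ℝ) + 1 / (τ * ξ) * (1 + Real.log (1 / ξ)) with hXdef
  have hprod : 0 < (s.card : ℝ) * V.card := by
    have hlog : 0 ≤ Real.log (1 / ξ) := Real.log_nonneg (by rwa [le_div_iff₀ hξ, one_mul])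
    refine lt_of_le_of_lt ?_ hbig
    positivity
  have hlt : 4 * (H : ℝ) ^ 2 * X < s.card * V.card := by
    refine lt_of_le_of_lt ?_ hbig
    rw [hHr]
    gcongr
  have hfin : (s.card * V.card : ℝ) * (H ^ 2 * (s.card * V.card)) ≤
      (s.card * V.card : ℝ) * (H ^ 2 * (4 * H ^ 2 * X)) := by
    have e1 : (s.card * V.card : ℝ) * (H ^ 2 * (s.card * V.card)) =
        4 * (s.card * (H * V.card / 2) : ℝ) ^ 2 := by ring
    have e2 : (s.card * V.card : ℝ) * (H ^ 2 * (4 * H ^ 2 * X)) =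
        4 * ((s.card * H ^ 2) * (H ^ 2 * E)) := by rw [hE]; ring
    rw [e1, e2]
    linarith
  have h8 := le_of_mul_le_mul_left hfin hprod
  have h9 := le_of_mul_le_mul_left h8 (by positivity)
  linarith

namespace Mob

lemma c_mul_eq (g h : Mob) : ((g * h).c : ℝ) = h.c * (g.c + h.f 0 * g.d) := by
  have := h.c_pos.ne'
  rw [h.f_zero, mul_c]
  push_cast
  field_simp

lemma f_eq (g : Mob) {t : ℝ} (ht : 0 ≤ t) :
    g.f t = g.f 0 + 1 / (g.c : ℝ) ^ 2 * (t / (1 + g.d / g.c * t)) := by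
  have h1 := g.f_sub ht le_rfl
  have h2 := g.c_pos
  have h3 := g.den_pos ht
  have h4 : (1 : ℝ) + g.d / g.c * t = (g.c + g.d * t) / g.c := by field_simp
  rw [sub_eq_iff_eq_add'.1 h1, h4]
  congr 1
  have h5 := h3.ne'
  rw [mul_zero, add_zero, sub_zero]
  field_simp

lemma ratio_mul_sub (g h : Mob) : |((g * h).d : ℝ) / (g * h).c - h.d / h.c| ≤ 1 / (h.c : ℝ) ^ 2 := by
  have h1 := h.c_pos
  have h2 := (g * h).c_pos
  have h3 : ((g * h).d : ℝ) / (g * h).c - h.d / h.c = g.d / ((g * h).c * h.c) := by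
    rw [div_sub_div _ _ h2.ne' h1.ne']
    congr 1
    push_cast [mul_c, mul_d]
    linear_combination (g.d : ℝ) * h.detR
  rw [h3, abs_of_nonneg (div_nonneg g.d_ge (by positivity))]
  rw [div_le_div_iff₀ (by positivity) (by positivity)]
  have h4 := le_c_mul g h
  have h5 := g.d_le
  have : (g.d : ℝ) * h.c ≤ (g * h).c := le_trans (by gcongr) h4
  nlinarith

end Mob

lemma abs_div_one_add_sub_le {r r' t ε : ℝ} (hr : 0 ≤ r) (hr' : 0 ≤ r') (ht : t ∈ Icc (0 : ℝ) 1)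
    (h : |r - r'| ≤ ε) : |t / (1 + r * t) - t / (1 + r' * t)| ≤ ε := by
  have h1 : 1 ≤ 1 + r * t := by nlinarith [mul_nonneg hr ht.1]
  have h2 : 1 ≤ 1 + r' * t := by nlinarith [mul_nonneg hr' ht.1]
  have h3 : t / (1 + r * t) - t / (1 + r' * t) = (r' - r) * (t ^ 2 / ((1 + r * t) * (1 + r' * t))) := by
    rw [div_sub_div _ _ (by linarith) (by linarith)]
    ring
  have h4 : t ^ 2 / ((1 + r * t) * (1 + r' * t)) ≤ 1 := by
    rw [div_le_one (by positivity)]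
    nlinarith [ht.1, ht.2]
  have h5 : 0 ≤ t ^ 2 / ((1 + r * t) * (1 + r' * t)) := by positivity
  rw [h3, abs_mul, abs_of_nonneg h5, abs_sub_comm]
  nlinarith [abs_nonneg (r - r')]

lemma le_abs_div_one_add_sub {r t t' : ℝ} (hr : r ∈ Icc (0 : ℝ) 1) (ht : t ∈ Icc (0 : ℝ) 1)
    (ht' : t' ∈ Icc (0 : ℝ) 1) : |t - t'| / 4 ≤ |t / (1 + r * t) - t' / (1 + r * t')| := by
  have h1 : 1 ≤ 1 + r * t := by nlinarith [mul_nonneg hr.1 ht.1]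
  have h2 : 1 ≤ 1 + r * t' := by nlinarith [mul_nonneg hr.1 ht'.1]
  have h3 : 1 + r * t ≤ 2 := by nlinarith [hr.1, hr.2, ht.1, ht.2]
  have h4 : 1 + r * t' ≤ 2 := by nlinarith [hr.1, hr.2, ht'.1, ht'.2]
  have h5 : t / (1 + r * t) - t' / (1 + r * t') = (t - t') / ((1 + r * t) * (1 + r * t')) := by
    rw [div_sub_div _ _ (by linarith) (by linarith)]
    ring
  have h6 : 0 < (1 + r * t) * (1 + r * t') := by positivity
  rw [h5, abs_div, abs_of_pos h6]
  gcongr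
  nlinarith

lemma le_abs_inv_sq_sub {c B A σ x y : ℝ} (hA : 0 ≤ A) (hc : 0 < c) (hB : 0 < B) (hx : c ≤ x) (hy : c ≤ y)
    (hxB : x ≤ c * B) (hyB : y ≤ c * B) (hxy : σ * c ≤ |x - y|) (hσ : 0 ≤ σ) :
    A * σ / B ^ 3 ≤ |A * (c / x) ^ 2 - A * (c / y) ^ 2| := by
  wlog hle : x ≤ y generalizing x y
  · rw [abs_sub_comm]
    exact this hy hx hyB hxB (by rwa [abs_sub_comm]) (le_of_not_ge hle)
  have hx0 : 0 < x := hc.trans_le hx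
  have hy0 : 0 < y := hc.trans_le hy
  rw [abs_sub_comm, abs_of_nonneg (sub_nonneg.2 hle)] at hxy
  have h1 : A * (c / x) ^ 2 - A * (c / y) ^ 2 = A * (c ^ 2 * (y - x) * (x + y) / (x ^ 2 * y ^ 2)) := by
    field_simp
    ring
  rw [h1]
  refine le_trans ?_ (le_abs_self _)
  rw [mul_div_assoc]
  refine mul_le_mul_of_nonneg_left ?_ hA
  rw [div_le_div_iff₀ (by positivity) (by positivity)]
  have h2 : x ^ 2 * y ≤ (c * B) ^ 3 := by
    calc x ^ 2 * y ≤ (c * B) ^ 2 * (c * B) := by gcongr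
      _ = _ := by ring
  calc σ * (x ^ 2 * y ^ 2) = σ * y * (x ^ 2 * y) := by ring
    _ ≤ σ * (x + y) * (c * B) ^ 3 := by gcongr; linarith
    _ = c ^ 2 * (σ * c) * (x + y) * B ^ 3 := by ring
    _ ≤ c ^ 2 * (y - x) * (x + y) * B ^ 3 := by gcongr

namespace Adm

variable {U : Finset Mob} {D : ℕ}

lemma two_le_card (hU : Adm U D) : 2 ≤ U.card := by
  by_contra h
  have h1 : (U.card : ℝ) ≤ 1 := by exact_mod_cast (by omega : U.card ≤ 1)
  have h2 : (U.card : ℝ) ^ 5 ≤ 1 := pow_le_one₀ (by positivity) h1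
  have h3 : (2 : ℝ) ≤ (D : ℝ) ^ 9 := by
    calc (2 : ℝ) ≤ D := le_trans (by norm_num) hU.D_ge
      _ ≤ (D : ℝ) ^ 9 := le_self_pow₀ hU.one_le_D (by norm_num)
  linarith [hU.card_ge]

lemma exists_generic_word (hU : Adm U D) {W : Mob} (hW : W ∈ cl U) {l : ℕ}
    (hWc : 2 * (D : ℝ) ^ l ≤ W.c) {S : Finset Mob} (hScard : S.card = U.card ^ l)
    (hSc : ∀ g ∈ S, (g.c : ℝ) ≤ (D : ℝ) ^ l)
    (hSsep : ∀ g ∈ S, ∀ h ∈ S, g ≠ h → ∀ t ∈ Icc (0 : ℝ) 1, ∀ t' ∈ Icc (0 : ℝ) 1,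
      1 / (D : ℝ) ^ (2 * l) ≤ |g.f t - h.f t'|) :
    ∃ w ∈ cl U, (w.c : ℝ) ≤ (D : ℝ) ^ (2 * l + 1) ∧ ∀ t ∈ Icc (0 : ℝ) 1,
      ∀ g ∈ S, ∀ h ∈ S, g ≠ h → 1 / (D : ℝ) ^ (5 * l + 4) * W.c ≤
        |((W * g).c + w.f t * (W * g).d) - ((W * h).c + w.f t * (W * h).d)| := by
  classical
  obtain ⟨S3, hS3, hS3card, hS3c, hS3sep⟩ := hU.exists_words (2 * l + 1)
  by_contra hcon
  push Not at hcon
  have hD := hU.D_pos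
  have hex : ∀ w : Mob, ∃ q : ℝ × (Mob × Mob), w ∈ S3 → q.1 ∈ Icc (0 : ℝ) 1 ∧ q.2 ∈ S.offDiag ∧
      |((W * q.2.1).c + w.f q.1 * (W * q.2.1).d) - ((W * q.2.2).c + w.f q.1 * (W * q.2.2).d)| <
        1 / (D : ℝ) ^ (5 * l + 4) * W.c := by
    intro w
    by_cases hw : w ∈ S3
    · obtain ⟨t, ht, g, hg, h, hh, hne, hlt⟩ := hcon w (hS3 w hw) (hS3c w hw)
      exact ⟨(t, (g, h)), fun _ => ⟨ht, Finset.mem_offDiag.2 ⟨hg, hh, hne⟩, hlt⟩⟩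
    · exact ⟨(0, (1, 1)), fun h => absurd h hw⟩
  choose q hq using hex
  have hcard : S.offDiag.card < S3.card := by
    rw [Finset.offDiag_card, hS3card, hScard]
    have h2 := hU.two_le_card
    calc U.card ^ l * U.card ^ l - U.card ^ l ≤ U.card ^ l * U.card ^ l := Nat.sub_le _ _
      _ = U.card ^ (2 * l) := by rw [← pow_add]; ring_nf
      _ < U.card ^ (2 * l + 1) := Nat.pow_lt_pow_right (by omega) (by omega)
  obtain ⟨w, hw, w', hw', hne, heq⟩ := Finset.exists_ne_map_eq_of_card_lt_of_maps_to hcard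
    (f := fun w => (q w).2) (fun w hw => (hq w hw).2.1)
  obtain ⟨ht, hmem, hlt⟩ := hq w hw
  obtain ⟨ht', -, hlt'⟩ := hq w' hw'
  have heq' : (q w).2 = (q w').2 := heq
  rw [← heq'] at hlt'
  rw [Finset.mem_offDiag] at hmem
  obtain ⟨hg, hh, hgh⟩ := hmem
  set g := (q w).2.1
  set h := (q w).2.2
  set t := (q w).1
  set t' := (q w').1
  set θ := w.f t
  set θ' := w'.f t'
  have hθ : θ ∈ Icc (0 : ℝ) 1 := w.f_mem ht
  have hθθ : 1 / (D : ℝ) ^ (2 * (2 * l + 1)) ≤ |θ - θ'| := hS3sep w hw w' hw' hne t ht t' ht'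
  have hWp := W.c_pos
  have hD1 : |((W * g).c : ℝ) - (W * h).c| ≥ W.c / (8 * D * (D : ℝ) ^ l) := by
    have e1 : ((W * g).c : ℝ) - (W * h).c =
        ((g.c - h.c : ℤ) : ℝ) * W.c + ((g.a - h.a : ℤ) : ℝ) * W.d := by
      push_cast [Mob.mul_c]
      ring
    rw [e1]
    refine hU.abs_linear_form_ge hW (one_le_pow₀ hU.one_le_D) hWc ?_ ?_
    · rintro ⟨hc0, ha0⟩
      have h1 := hSsep g hg h hh hgh 0 (by simp) 0 (by simp)
      rw [g.f_zero, h.f_zero, show g.a = h.a by omega, show g.c = h.c by omega, sub_self,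
        abs_zero] at h1
      have : 0 < 1 / (D : ℝ) ^ (2 * l) := by positivity
      linarith
    · push_cast
      have a1 := hSc g hg
      have a2 := hSc h hh
      rw [abs_le]
      constructor <;> linarith [g.a_ge, g.a_le, h.a_ge, h.a_le]
  set d1 : ℝ := ((W * g).c : ℝ) - (W * h).c
  set d2 : ℝ := ((W * g).d : ℝ) - (W * h).d with hd2
  set σ : ℝ := 1 / (D : ℝ) ^ (5 * l + 4) with hσ
  have e1 : |d1 + θ * d2| < σ * W.c := by
    convert hlt using 2
    simp only [d1, d2]; ring
  have e2 : |d1 + θ' * d2| < σ * W.c := by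
    convert hlt' using 2
    simp only [d1, d2]; ring
  have e3 : |θ - θ'| * |d2| < 2 * (σ * W.c) := by
    rw [← abs_mul]
    have : (θ - θ') * d2 = (d1 + θ * d2) - (d1 + θ' * d2) := by ring
    rw [this]
    exact lt_of_le_of_lt (abs_sub _ _) (by linarith)
  set Q : ℝ := (D : ℝ) ^ (2 * (2 * l + 1)) with hQ
  have hQ1 : 1 ≤ Q := one_le_pow₀ hU.one_le_D
  have e4 : |d2| < 2 * (σ * W.c) * Q := by
    have : 1 / Q * |d2| < 2 * (σ * W.c) :=
      lt_of_le_of_lt (mul_le_mul_of_nonneg_right hθθ (abs_nonneg _)) e3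
    rw [one_div_mul_eq_div, div_lt_iff₀ (by positivity)] at this
    exact this
  have e5 : |d1| ≤ |d1 + θ * d2| + |d2| := by
    have h1 : |d1| ≤ |d1 + θ * d2| + |θ * d2| := by
      have := abs_sub (d1 + θ * d2) (θ * d2)
      rwa [add_sub_cancel_right] at this
    have h2 : |θ * d2| ≤ |d2| := by
      rw [abs_mul, abs_of_nonneg hθ.1]
      nlinarith [abs_nonneg d2, hθ.2]
    linarith
  have hσ0 : 0 < σ := by positivity
  have e6 : |d1| < 3 * (σ * W.c) * Q := by
    have : σ * W.c ≤ σ * W.c * Q := le_mul_of_one_le_right (by positivity) hQ1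
    linarith
  have e7 : 3 * (σ * W.c) * Q ≤ W.c / (8 * D * (D : ℝ) ^ l) := by
    rw [le_div_iff₀ (by positivity)]
    have e8 : σ * Q * (D * (D : ℝ) ^ l) * D = 1 := by
      rw [hσ, hQ, one_div_mul_eq_div, div_mul_eq_mul_div, div_mul_eq_mul_div,
        div_eq_one_iff_eq (by positivity)]
      ring
    have e9 : 24 * (σ * Q * (D * (D : ℝ) ^ l)) ≤ 1 := by
      have : (24 : ℝ) ≤ D := le_trans (by norm_num) hU.D_ge
      have h0 : 0 < σ * Q * (D * (D : ℝ) ^ l) := by positivity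
      nlinarith
    nlinarith
  linarith

end Adm

namespace Adm

variable {U : Finset Mob} {D : ℕ}

lemma count_bound (hU : Adm U D) {l : ℕ} (hl : 13 ≤ l) {A : ℝ}
    (hA : A ≤ (D : ℝ) ^ (8 * l + 7)) :
    4 * ((4 : ℝ) ^ l) ^ 2 * (2 * 4 ^ l * A + 1 + 2 * 4 ^ l / (1 / (D : ℝ) ^ (8 * l + 11)) *
      (1 + Real.log (1 / (1 / (D : ℝ) ^ (8 * l + 11))))) <
      (U.card ^ l : ℕ) * (U.card ^ (4 * l + 5) : ℕ) := by
  have hD := hU.D_pos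
  have hD1 := hU.one_le_D
  have hr : (D : ℝ) ^ (9 * l + 9) ≤ (U.card ^ l : ℕ) * (U.card ^ (4 * l + 5) : ℕ) := by
    have : ((U.card ^ l : ℕ) * (U.card ^ (4 * l + 5) : ℕ) : ℝ) = ((U.card : ℝ) ^ 5) ^ (l + 1) := by
      push_cast
      rw [← pow_add, ← pow_mul]
      ring_nf
    rw [this, show 9 * l + 9 = 9 * (l + 1) by ring, pow_mul]
    exact pow_le_pow_left₀ (by positivity) hU.card_ge _
  refine lt_of_lt_of_le ?_ hr
  rw [one_div_one_div, div_div_eq_mul_div, div_one, Real.log_pow]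
  set M : ℝ := (D : ℝ) ^ (8 * l + 11) with hM
  have hM1 : 1 ≤ M := one_le_pow₀ hD1
  have hAM : A ≤ M := hA.trans (pow_le_pow_right₀ hD1 (by omega))
  have hlog : Real.log D ≤ D := (Real.log_le_sub_one_of_pos hD).trans (by linarith)
  have h4 : (1 : ℝ) ≤ 4 ^ l := one_le_pow₀ (by norm_num)
  have h1 : 2 * 4 ^ l * A + 1 + 2 * 4 ^ l * M * (1 + ((8 * l + 11 : ℕ) : ℝ) * Real.log D) ≤
      4 ^ l * M * ((16 * l + 27) * D) := by
    have e1 : 2 * 4 ^ l * A ≤ 4 ^ l * M * (2 * D) := by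
      calc 2 * 4 ^ l * A ≤ 2 * 4 ^ l * M := by gcongr
        _ = 4 ^ l * M * (2 * 1) := by ring
        _ ≤ _ := by gcongr
    have e2 : (1 : ℝ) ≤ 4 ^ l * M * D := by
      have : (1 : ℝ) ≤ 4 ^ l * M := one_le_mul_of_one_le_of_one_le h4 hM1
      exact one_le_mul_of_one_le_of_one_le this hD1
    have e3 : 2 * 4 ^ l * M * (1 + ((8 * l + 11 : ℕ) : ℝ) * Real.log D) ≤
        4 ^ l * M * ((16 * l + 24) * D) := by
      calc 2 * 4 ^ l * M * (1 + ((8 * l + 11 : ℕ) : ℝ) * Real.log D)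
          ≤ 2 * 4 ^ l * M * (D + ((8 * l + 11 : ℕ) : ℝ) * D) := by gcongr
        _ = _ := by push_cast; ring
    calc _ ≤ 4 ^ l * M * (2 * D) + 4 ^ l * M * D + 4 ^ l * M * ((16 * l + 24) * D) := by linarith
      _ = _ := by ring
  obtain ⟨k, rfl⟩ := Nat.exists_eq_add_of_le hl
  have hk : (16 * ((13 + k : ℕ) : ℝ) + 27) ≤ 2 ^ (k + 8) := by
    have h5 : (k : ℝ) + 1 ≤ 2 ^ k := by exact_mod_cast Nat.lt_two_pow_self
    rw [pow_add]
    push_cast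
    nlinarith
  have hpow : (2 : ℝ) ^ (10 * (k + 10)) ≤ (D : ℝ) ^ (k + 10) := by
    rw [pow_mul]
    exact pow_le_pow_left₀ (by positivity) hU.D_ge _
  calc 4 * ((4 : ℝ) ^ (13 + k)) ^ 2 * (2 * 4 ^ (13 + k) * A + 1 + 2 * 4 ^ (13 + k) * M *
        (1 + ((8 * (13 + k) + 11 : ℕ) : ℝ) * Real.log D))
      ≤ 4 * ((4 : ℝ) ^ (13 + k)) ^ 2 * (4 ^ (13 + k) * M * ((16 * ((13 + k : ℕ) : ℝ) + 27) * D)) := by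
        gcongr
    _ ≤ 4 * ((4 : ℝ) ^ (13 + k)) ^ 2 * (4 ^ (13 + k) * M * (2 ^ (k + 8) * D)) := by gcongr
    _ = 2 ^ (7 * k + 88) * (M * D) := by
      rw [show (4 : ℝ) = 2 ^ 2 by norm_num]
      simp only [← pow_mul, ← mul_assoc, ← pow_add]
      ring
    _ < 2 ^ (10 * (k + 10)) * (M * D) := by
      gcongr
      · norm_num
      · omega
    _ ≤ (D : ℝ) ^ (k + 10) * (M * D) := by gcongr
    _ = _ := by
      rw [hM]
      ring

lemma exists_forced (hU : Adm U D) {W : Mob} (hW : W ∈ cl U) {l : ℕ} (hl : 13 ≤ l)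
    (hWc : 2 * (D : ℝ) ^ l ≤ W.c) {n : ℝ} (hn1 : (D : ℝ) ^ (17 * l + 20) * (W.c : ℝ) ^ 2 ≤ n)
    (hn2 : n ≤ (D : ℝ) ^ (17 * l + 22) * (W.c : ℝ) ^ 2) (δ : ℝ) :
    ∃ v ∈ cl U, ((W * v).c : ℝ) ≤ (D : ℝ) ^ (15 * l + 21) * W.c ∧ n ≤ ((W * v).c : ℝ) ^ 2 ∧
      ∀ t ∈ Icc (0 : ℝ) 1, ∃ z : ℤ, |n * (W * v).f t - δ - z| ≤ 4 * (1 / 2 : ℝ) ^ l := by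
  classical
  have hD := hU.D_pos
  have hD1 := hU.one_le_D
  have hWp := W.c_pos
  have h2D : (2 : ℝ) ≤ D := le_trans (by norm_num) hU.D_ge
  have hn0 : 0 < n := lt_of_lt_of_le (by positivity) hn1
  obtain ⟨S, hS, hScard, hSc, hSsep⟩ := hU.exists_words l
  obtain ⟨w3, hw3, hw3c, hgen⟩ := hU.exists_generic_word hW hWc hScard hSc hSsep
  set R : ℝ := n / ((W.c : ℝ) ^ 2 * (D : ℝ) ^ (8 * l + 7)) with hR
  have hR0 : 0 < R := by positivity
  have hR1 : (D : ℝ) ^ (9 * l + 13) ≤ R := by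
    rw [hR, le_div_iff₀ (by positivity)]
    calc _ = (D : ℝ) ^ (17 * l + 20) * (W.c : ℝ) ^ 2 := by ring
      _ ≤ n := hn1
  have hR2 : R ≤ (D : ℝ) ^ (9 * l + 15) := by
    rw [hR, div_le_iff₀ (by positivity)]
    calc n ≤ (D : ℝ) ^ (17 * l + 22) * (W.c : ℝ) ^ 2 := hn2
      _ = _ := by ring
  set Y := √R with hY
  have hY0 : 0 < Y := Real.sqrt_pos.2 hR0
  have hYR : Y ^ 2 = R := Real.sq_sqrt hR0.le
  have hw3Y : (w3.c : ℝ) ≤ Y := by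
    apply Real.le_sqrt_of_sq_le
    calc (w3.c : ℝ) ^ 2 ≤ ((D : ℝ) ^ (2 * l + 1)) ^ 2 := by
          have := w3.c_pos
          gcongr
      _ = (D : ℝ) ^ (4 * l + 2) := by ring
      _ ≤ (D : ℝ) ^ (9 * l + 13) := pow_le_pow_right₀ hD1 (by omega)
      _ ≤ R := hR1
  have hYD : Y ≤ (D : ℝ) ^ (5 * l + 8) := by
    rw [hY]
    apply Real.sqrt_le_iff.2
    refine ⟨by positivity, hR2.trans ?_⟩
    rw [← pow_mul]
    exact pow_le_pow_right₀ hD1 (by omega)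
  obtain ⟨w4, hw4, hc2lo, hc2hi⟩ := hU.exists_extend w3 hw3Y
  have hw2 : w3 * w4 ∈ cl U := mul_mem hw3 hw4
  have hw2f : ∀ t : ℝ, 0 ≤ t → (w3 * w4).f t = w3.f (w4.f t) := fun t ht => w3.f_mul w4 ht
  set w2 := w3 * w4 with hw2def
  have hc2 := w2.c_pos
  set A : ℝ := n / ((w2.c : ℝ) ^ 2 * (W.c : ℝ) ^ 2) with hAdef
  have hA0 : 0 < A := by positivity
  have hnR : n = R * ((W.c : ℝ) ^ 2 * (D : ℝ) ^ (8 * l + 7)) := by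
    rw [hR]; field_simp
  have hA1 : A ≤ (D : ℝ) ^ (8 * l + 7) := by
    rw [hAdef, div_le_iff₀ (by positivity)]
    calc n = Y ^ 2 * ((W.c : ℝ) ^ 2 * (D : ℝ) ^ (8 * l + 7)) := by rw [hYR, ← hnR]
      _ ≤ (w2.c : ℝ) ^ 2 * ((W.c : ℝ) ^ 2 * (D : ℝ) ^ (8 * l + 7)) := by gcongr
      _ = _ := by ring
  have hA2 : (D : ℝ) ^ (8 * l + 5) ≤ A := by
    rw [hAdef, le_div_iff₀ (by positivity)]
    calc (D : ℝ) ^ (8 * l + 5) * ((w2.c : ℝ) ^ 2 * (W.c : ℝ) ^ 2) ≤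
          (D : ℝ) ^ (8 * l + 5) * ((D * Y) ^ 2 * (W.c : ℝ) ^ 2) := by gcongr
      _ = Y ^ 2 * ((W.c : ℝ) ^ 2 * (D : ℝ) ^ (8 * l + 7)) := by ring
      _ = n := by rw [hYR, ← hnR]
  have hhalf : ∀ a b : ℕ, a + l ≤ b → (D : ℝ) ^ a ≤ (1 / 2 : ℝ) ^ l * (D : ℝ) ^ b := by
    intro a b hab
    calc (D : ℝ) ^ a = (1 / 2 : ℝ) ^ l * ((D : ℝ) ^ a * 2 ^ l) := by
          rw [mul_comm ((D : ℝ) ^ a), ← mul_assoc, ← mul_pow]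
          norm_num
      _ ≤ (1 / 2 : ℝ) ^ l * ((D : ℝ) ^ a * (D : ℝ) ^ l) := by gcongr
      _ = (1 / 2 : ℝ) ^ l * (D : ℝ) ^ (a + l) := by rw [pow_add]
      _ ≤ _ := by gcongr
  have hAc2 : A * (1 / (w2.c : ℝ) ^ 2) ≤ (1 / 2 : ℝ) ^ l := by
    rw [mul_one_div, div_le_iff₀ (by positivity)]
    calc A ≤ (D : ℝ) ^ (8 * l + 7) := hA1
      _ ≤ (1 / 2 : ℝ) ^ l * (D : ℝ) ^ (9 * l + 13) := hhalf _ _ (by omega)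
      _ ≤ (1 / 2 : ℝ) ^ l * (w2.c : ℝ) ^ 2 := by
        gcongr
        rw [← hYR] at hR1
        exact hR1.trans (by gcongr)
  obtain ⟨V, hV, hVcard, hVc, hVsep⟩ := hU.exists_words (4 * l + 5)
  obtain ⟨e, he, helo, hehi⟩ := hU.exists_extend 1 (Y := (D : ℝ) ^ (5 * l + 5))
    (by simpa using one_le_pow₀ hD1)
  rw [one_mul] at helo hehi
  have hAe : A ≤ (1 / 2 : ℝ) ^ l * (e.c : ℝ) ^ 2 := by
    calc A ≤ (D : ℝ) ^ (8 * l + 7) := hA1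
      _ ≤ (1 / 2 : ℝ) ^ l * (D : ℝ) ^ (2 * (5 * l + 5)) := hhalf _ _ (by omega)
      _ = (1 / 2 : ℝ) ^ l * ((D : ℝ) ^ (5 * l + 5)) ^ 2 := by ring
      _ ≤ _ := by gcongr
  set θ := w2.f 0 with hθ
  have hθ01 : θ ∈ Icc (0 : ℝ) 1 := w2.f_mem (by simp)
  set X : Mob → ℝ := fun g => (W * g).c + θ * (W * g).d with hX
  have hXc : ∀ g, ((W * g * w2).c : ℝ) = w2.c * X g := fun g => (W * g).c_mul_eq w2
  have hXlo : ∀ g, (W.c : ℝ) ≤ X g := fun g =>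
    (W.c_le_mul_left g).trans (le_add_of_nonneg_right (mul_nonneg hθ01.1 (W * g).d_ge))
  have hXhi : ∀ g ∈ S, X g ≤ W.c * (4 * (D : ℝ) ^ l) := by
    intro g hg
    have h1 := W.c_mul_le g
    have h2 := (W * g).d_le
    have h3 := (W * g).d_ge
    have h4 : (W.c : ℝ) * g.c ≤ W.c * (D : ℝ) ^ l := by
      have := hSc g hg
      gcongr
    have h5 : θ * (W * g).d ≤ (W * g).d := mul_le_of_le_one_left h3 hθ01.2
    simp only [hX]
    linarith
  set T : Mob → ℝ := fun g => A * (W.c / X g) ^ 2 with hT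
  have hTn : ∀ g, n * (1 / ((W * g * w2).c : ℝ) ^ 2) = T g := by
    intro g
    have := (hWp.trans_le (hXlo g)).ne'
    simp only [hT]
    rw [hXc, hAdef]
    field_simp
  set r : ℝ := (w2.d : ℝ) / w2.c with hr
  have hr01 : r ∈ Icc (0 : ℝ) 1 := ⟨div_nonneg w2.d_ge hc2.le, (div_le_one hc2).2 w2.d_le⟩
  set G : Mob → ℝ := fun v => v.f (e.f 0) / (1 + r * v.f (e.f 0)) with hG
  have he0 : e.f 0 ∈ Icc (0 : ℝ) 1 := e.f_mem (by simp)
  have hT01 : ∀ g, T g ∈ Icc 0 A := by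
    intro g
    have h1 := hWp.trans_le (hXlo g)
    have h2 : (W.c : ℝ) / X g ≤ 1 := (div_le_one h1).2 (hXlo g)
    have h3 : ((W.c : ℝ) / X g) ^ 2 ≤ 1 := pow_le_one₀ (by positivity) h2
    exact ⟨by positivity, by simp only [hT]; nlinarith⟩
  have hTsep : ∀ g ∈ S, ∀ h ∈ S, g ≠ h → 1 ≤ |T g - T h| := by
    intro g hg h hh hne
    have h1 := hgen (w4.f 0) (w4.f_mem (by simp)) g hg h hh hne
    rw [← hw2f 0 le_rfl] at h1
    refine le_trans ?_ (le_abs_inv_sq_sub hA0.le hWp (by positivity) (hXlo g) (hXlo h)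
      (hXhi g hg) (hXhi h hh) h1 (by positivity))
    rw [le_div_iff₀ (by positivity), mul_one_div, le_div_iff₀ (by positivity), one_mul]
    calc (4 * (D : ℝ) ^ l) ^ 3 * (D : ℝ) ^ (5 * l + 4) = 64 * (D : ℝ) ^ (8 * l + 4) := by ring
      _ ≤ D * (D : ℝ) ^ (8 * l + 4) := by
        gcongr
        exact le_trans (by norm_num) hU.D_ge
      _ = (D : ℝ) ^ (8 * l + 5) := by ring
      _ ≤ A := hA2
  have hG01 : ∀ v ∈ V, G v ∈ Icc (0 : ℝ) 1 := by
    intro v hv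
    have h1 := v.f_mem he0
    have h2 : 1 ≤ 1 + r * v.f (e.f 0) := le_add_of_nonneg_right (mul_nonneg hr01.1 h1.1)
    exact ⟨div_nonneg h1.1 (by linarith), (div_le_one (by linarith)).2 (h1.2.trans h2)⟩
  have hGsep : ∀ v ∈ V, ∀ w ∈ V, v ≠ w → 1 / (D : ℝ) ^ (8 * l + 11) ≤ |G v - G w| := by
    intro v hv w hw hne
    have h1 := hVsep v hv w hw hne _ he0 _ he0
    refine le_trans ?_ (le_abs_div_one_add_sub hr01 (v.f_mem he0) (w.f_mem he0))
    calc 1 / (D : ℝ) ^ (8 * l + 11) = 1 / (D : ℝ) ^ (2 * (4 * l + 5)) / D := by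
          rw [div_div, ← pow_succ]; ring_nf
      _ ≤ |v.f (e.f 0) - w.f (e.f 0)| / 4 := by
        gcongr
        exact le_trans (by norm_num) hU.D_ge
  obtain ⟨g, hg, v, hv, z, hz⟩ := exists_near_int S V T G (fun g => δ - n * (W * g * w2).f 0) l
    hA0.le (ξ := 1 / (D : ℝ) ^ (8 * l + 11)) (by positivity)
    (by rw [div_le_one (by positivity)]; exact one_le_pow₀ hD1) (fun g _ => hT01 g) hTsep hG01 hGsep
    (by rw [hScard, hVcard]; exact hU.count_bound hl hA1)
  have hassoc : W * (g * w2 * v * e) = W * g * w2 * v * e := by simp only [mul_assoc]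
  have hnc : n ≤ (1 / 2 : ℝ) ^ l * ((W * g * w2 * v * e).c : ℝ) ^ 2 := by
    have h1 : (W.c : ℝ) * w2.c * e.c ≤ (W * g * w2 * v * e).c := by
      calc (W.c : ℝ) * w2.c * e.c ≤ (W * g).c * w2.c * e.c := by
            have := e.c_pos
            gcongr
            exact_mod_cast W.c_le_mul_left g
        _ ≤ (W * g * w2).c * e.c := by
            have := e.c_pos
            gcongr
            exact (W * g).le_c_mul w2
        _ ≤ (W * g * w2 * v).c * e.c := by
            have := e.c_pos
            gcongr
            exact_mod_cast (W * g * w2).c_le_mul_left v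
        _ ≤ _ := (W * g * w2 * v).le_c_mul e
    have hepos := e.c_pos
    calc n = A * ((w2.c : ℝ) ^ 2 * (W.c : ℝ) ^ 2) := by rw [hAdef]; field_simp
      _ ≤ ((1 / 2 : ℝ) ^ l * (e.c : ℝ) ^ 2) * ((w2.c : ℝ) ^ 2 * (W.c : ℝ) ^ 2) := by gcongr
      _ = (1 / 2 : ℝ) ^ l * (W.c * w2.c * e.c) ^ 2 := by ring
      _ ≤ _ := by gcongr
  have hhalf1 : (1 / 2 : ℝ) ^ l ≤ 1 := pow_le_one₀ (by norm_num) (by norm_num)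
  refine ⟨g * w2 * v * e, mul_mem (mul_mem (mul_mem (hS g hg) hw2) (hV v hv)) he, ?_, ?_, ?_⟩
  · rw [hassoc]
    have h1 := W.c_mul_le g
    have h2 := (W * g).c_mul_le w2
    have h3 := (W * g * w2).c_mul_le v
    have h4 := (W * g * w2 * v).c_mul_le e
    have p1 := g.c_pos
    have p2 := v.c_pos
    have p3 := e.c_pos
    have p4 := (W * g).c_pos
    have p5 := (W * g * w2).c_pos
    calc ((W * g * w2 * v * e).c : ℝ) ≤ 2 * ((2 * ((2 * ((2 * (W.c * g.c)) * w2.c)) * v.c)) * e.c) := by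
          refine h4.trans ?_
          gcongr
          refine h3.trans ?_
          gcongr
          refine h2.trans ?_
          gcongr
      _ ≤ 2 * ((2 * ((2 * ((2 * (W.c * (D : ℝ) ^ l)) * (D * (D : ℝ) ^ (5 * l + 8)))) *
          (D : ℝ) ^ (4 * l + 5))) * (D * (D : ℝ) ^ (5 * l + 5))) := by
          have q1 := hSc g hg
          have q2 := hVc v hv
          have q3 : (w2.c : ℝ) ≤ D * (D : ℝ) ^ (5 * l + 8) := hc2hi.trans (by gcongr)
          gcongr
      _ = 16 * ((D : ℝ) ^ (15 * l + 20) * W.c) := by ring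
      _ ≤ D * ((D : ℝ) ^ (15 * l + 20) * W.c) := by
          gcongr
          exact le_trans (by norm_num) hU.D_ge
      _ = _ := by ring
  · rw [hassoc]
    refine hnc.trans ?_
    exact mul_le_of_le_one_left (by positivity) hhalf1
  · intro t ht
    refine ⟨z, ?_⟩
    rw [hassoc]
    set P := W * g * w2 * v * e with hP
    have hPp := P.c_pos
    have d1 : |n * P.f t - n * P.f 0| ≤ (1 / 2 : ℝ) ^ l := by
      rw [← mul_sub, abs_mul, abs_of_pos hn0]
      have h1 := P.abs_f_sub_le ht.1 le_rfl
      have h2 : |t - 0| / (P.c : ℝ) ^ 2 ≤ 1 / (P.c : ℝ) ^ 2 := by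
        gcongr
        rw [sub_zero, abs_of_nonneg ht.1]
        exact ht.2
      calc n * |P.f t - P.f 0| ≤ n * (1 / (P.c : ℝ) ^ 2) := by gcongr; exact h1.trans h2
        _ ≤ _ := by
          rw [mul_one_div, div_le_iff₀ (by positivity)]
          exact hnc
    have hs := v.f_mem he0
    have d2 : n * P.f 0 = n * (W * g * w2).f 0 + T g * (v.f (e.f 0) /
        (1 + ((W * g * w2).d : ℝ) / (W * g * w2).c * v.f (e.f 0))) := by
      rw [hP, Mob.f_mul _ e le_rfl, Mob.f_mul _ v he0.1, Mob.f_eq _ hs.1, mul_add, ← hTn]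
      ring
    have d3 : |T g * (v.f (e.f 0) / (1 + ((W * g * w2).d : ℝ) / (W * g * w2).c * v.f (e.f 0))) -
        T g * G v| ≤ (1 / 2 : ℝ) ^ l := by
      rw [← mul_sub, abs_mul, abs_of_nonneg (hT01 g).1]
      have h1 := abs_div_one_add_sub_le (div_nonneg (W * g * w2).d_ge (W * g * w2).c_pos.le)
        hr01.1 hs ((W * g).ratio_mul_sub w2)
      refine le_trans ?_ hAc2
      exact mul_le_mul (hT01 g).2 h1 (abs_nonneg _) hA0.le
    have d4 : n * P.f t - δ - z = (n * P.f t - n * P.f 0) +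
        (T g * (v.f (e.f 0) / (1 + ((W * g * w2).d : ℝ) / (W * g * w2).c * v.f (e.f 0))) -
        T g * G v) + (T g * G v - (δ - n * (W * g * w2).f 0) - z) := by
      rw [d2]; ring
    rw [d4]
    have t1 := abs_add_three (n * P.f t - n * P.f 0)
      (T g * (v.f (e.f 0) / (1 + ((W * g * w2).d : ℝ) / (W * g * w2).c * v.f (e.f 0))) -
        T g * G v) (T g * G v - (δ - n * (W * g * w2).f 0) - z)
    linarith

end Adm

lemma nint_le_abs (x : ℝ) (z : ℤ) : nint x ≤ |x - z| :=
  ciInf_le ⟨0, by rintro _ ⟨n, rfl⟩; exact abs_nonneg _⟩ z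

lemma nint_nonneg (x : ℝ) : 0 ≤ nint x := Real.iInf_nonneg fun _ => abs_nonneg _

section ContinuedFraction

open GenContFract

lemma Irrational.not_terminatedAt {α : ℝ} (hα : Irrational α) (n : ℕ) :
    ¬ (GenContFract.of α).TerminatedAt n := fun h => by
  obtain ⟨q, hq⟩ := (terminates_iff_rat α).1 ⟨n, h⟩
  exact hα ⟨q, hq.symm⟩

lemma Irrational.exists_convergents {α : ℝ} (hα : Irrational α) :
    ∃ p q : ℕ → ℤ, (∀ k, contDen α k = q k) ∧ (∀ k, 1 ≤ q k) ∧ (∀ k, 2 * q k ≤ q (k + 2)) ∧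
      (∀ k, IsCoprime (p k) (q k)) ∧ ∀ k, |α - p k / q k| ≤ 1 / (q k : ℝ) ^ 2 := by
  have hnt := hα.not_terminatedAt
  have hs (n : ℕ) : ∃ b : ℤ, (GenContFract.of α).s.get? n = some ⟨1, b⟩ ∧ 1 ≤ b := by
    obtain ⟨gp, hgp⟩ := Option.ne_none_iff_exists'.1 (hnt n)
    obtain ⟨h1, z, hz⟩ := of_partNum_eq_one_and_exists_int_partDen_eq hgp
    refine ⟨z, by rw [hgp, ← h1, ← hz], ?_⟩
    have := of_one_le_get?_partDen (partDen_eq_s_b hgp)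
    rw [hz] at this
    exact_mod_cast this
  have hint (n : ℕ) : (∃ z : ℤ, (GenContFract.of α).nums n = z) ∧
      (∃ z : ℤ, (GenContFract.of α).dens n = z) := by
    induction n using Nat.twoStepInduction with
    | zero =>
      exact ⟨⟨⌊α⌋, by rw [zeroth_num_eq_h, of_h_eq_floor]⟩, ⟨1, by rw [zeroth_den_eq_one]; simp⟩⟩
    | one =>
      obtain ⟨b, hb, -⟩ := hs 0
      refine ⟨⟨b * ⌊α⌋ + 1, ?_⟩, ⟨b, ?_⟩⟩
      · rw [first_num_eq hb, of_h_eq_floor]; push_cast; ring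
      · rw [first_den_eq hb]
    | more n h0 h1 =>
      obtain ⟨⟨p0, hp0⟩, q0, hq0⟩ := h0
      obtain ⟨⟨p1, hp1⟩, q1, hq1⟩ := h1
      obtain ⟨b, hb, -⟩ := hs (n + 1)
      refine ⟨⟨b * p1 + p0, ?_⟩, ⟨b * q1 + q0, ?_⟩⟩
      · rw [nums_recurrence hb hp0 hp1]; push_cast; ring
      · rw [dens_recurrence hb hq0 hq1]; push_cast; ring
  choose p hp using fun n => (hint n).1
  choose q hq using fun n => (hint n).2
  have hone (k : ℕ) : 1 ≤ q k := by
    have h := succ_nth_fib_le_of_nth_den (v := α) (n := k) (Or.inr (hnt _))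
    rw [hq] at h
    have h2 : 1 ≤ Nat.fib (k + 1) := Nat.fib_pos.2 k.succ_pos
    have h3 : (1 : ℝ) ≤ Nat.fib (k + 1) := by exact_mod_cast h2
    exact_mod_cast h3.trans h
  have hmono (k : ℕ) : q k ≤ q (k + 1) := by
    have h := of_den_mono (v := α) (n := k)
    rw [hq, hq] at h
    exact_mod_cast h
  refine ⟨p, q, hq, hone, fun k => ?_, fun k => ?_, fun k => ?_⟩
  · obtain ⟨b, hb, hb1⟩ := hs (k + 1)
    have h := dens_recurrence hb (hq k) (hq (k + 1))
    rw [hq] at h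
    have h' : q (k + 2) = b * q (k + 1) + q k := by
      have : ((q (k + 2) : ℤ) : ℝ) = ((b * q (k + 1) + q k : ℤ) : ℝ) := by
        rw [h]; push_cast; ring
      exact_mod_cast this
    nlinarith [hmono k, hone k, hone (k + 1)]
  · have h := SimpContFract.determinant (s := ⟨GenContFract.of α, of_isSimpContFract α⟩) (hnt k)
    simp only [hp, hq] at h
    have h' : p k * q (k + 1) - q k * p (k + 1) = (-1) ^ (k + 1) := by exact_mod_cast h
    have hsq : ((-1 : ℤ) ^ (k + 1)) * (-1) ^ (k + 1) = 1 := by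
      rw [← mul_pow]; simp
    exact ⟨(-1) ^ (k + 1) * q (k + 1), -(-1) ^ (k + 1) * p (k + 1), by
      linear_combination (-1) ^ (k + 1) * h' + hsq⟩
  · have h := abs_sub_convs_le (hnt k)
    rw [conv_eq_num_div_den, hp, hq, hq] at h
    have h1 : (1 : ℝ) ≤ q k := by exact_mod_cast hone k
    have h2 : (q k : ℝ) ≤ q (k + 1) := by exact_mod_cast hmono k
    refine h.trans ?_
    rw [sq]
    gcongr

end ContinuedFraction

lemma exists_mul_nint_le {α : ℝ} {p q : ℤ} (hq : 1 ≤ q) (hpq : IsCoprime p q)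
    (h : |α - p / q| ≤ 1 / (q : ℝ) ^ 2) (γ : ℝ) :
    ∃ N : ℕ, q ≤ N ∧ (N : ℤ) < 2 * q ∧ N * nint (N * α - γ) ≤ 5 := by
  obtain ⟨a, b, hab⟩ := hpq
  set m := round (q * γ) with hm
  have hq0 : (0 : ℝ) < q := by exact_mod_cast hq
  have h1 := Int.emod_nonneg (m * a) (show q ≠ 0 by lia)
  have h2 := Int.emod_lt_of_pos (m * a) (show 0 < q by lia)
  obtain ⟨N, hN⟩ := Int.eq_ofNat_of_zero_le (show 0 ≤ q + m * a % q by lia)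
  refine ⟨N, by lia, by lia, ?_⟩
  have hN2 : (N : ℝ) < 2 * q := by
    have : (N : ℤ) < 2 * q := by lia
    exact_mod_cast this
  have hNm : ∃ z : ℤ, (N : ℤ) * p = m + q * z := by
    have h3 := Int.mul_ediv_add_emod (m * a) q
    refine ⟨p - m * b - m * a / q * p, ?_⟩
    rw [← hN]
    linear_combination p * h3 + m * hab
  obtain ⟨z, hz⟩ := hNm
  have hz' : (N : ℝ) * p = m + q * z := by exact_mod_cast hz
  have h4 : |(q : ℝ) * γ - m| ≤ 1 / 2 := abs_sub_round _
  have h5 : nint (N * α - γ) ≤ 5 / (2 * q) := by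
    refine (nint_le_abs _ z).trans ?_
    have : N * α - γ - z = N * (α - p / q) - (q * γ - m) / q := by
      field_simp
      linear_combination hz'
    rw [this]
    refine (abs_sub _ _).trans ?_
    rw [abs_mul, abs_div, abs_of_pos hq0, Nat.abs_cast]
    calc N * |α - p / q| + |(q : ℝ) * γ - m| / q
        ≤ 2 * q * (1 / (q : ℝ) ^ 2) + 1 / 2 / q := by gcongr
      _ = 5 / (2 * q) := by field_simp; norm_num
  calc N * nint (N * α - γ) ≤ 2 * q * (5 / (2 * q)) := by
        have := nint_nonneg (N * α - γ)
        gcongr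
    _ = 5 := by field_simp

lemma memK.exists_seq {α : ℝ} (hα : memK α) (γ : ℝ) :
    ∃ N : ℕ → ℕ, ∃ C : ℝ, 1 ≤ C ∧ (∀ k, 1 ≤ N k) ∧ (∀ k, 2 * N k ≤ N (k + 1)) ∧
      (∀ k, Real.log (N k) ≤ C * (k + 1)) ∧ ∀ k, N k * nint (N k * α - γ) ≤ 5 := by
  obtain ⟨hirr, B, hB⟩ := hα
  obtain ⟨p, q, hqd, hq1, hq2, hpq, happ⟩ := hirr.exists_convergents
  choose N hN1 hN2 hN3 using fun k => exists_mul_nint_le (hq1 (4 * k)) (hpq (4 * k))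
    (happ (4 * k)) γ
  refine ⟨N, 4 * |B| + 1, by linarith [abs_nonneg B], fun k => ?_, fun k => ?_, fun k => ?_, hN3⟩
  · have := hq1 (4 * k); have := hN1 k; lia
  · have h1 := hq2 (4 * k)
    have h2 := hq2 (4 * k + 2)
    have h3 := hN1 (k + 1)
    have h4 := hN2 k
    rw [show 4 * (k + 1) = 4 * k + 2 + 2 by ring] at h3
    lia
  · have hq0 : (0 : ℝ) < q (4 * k) := by have := hq1 (4 * k); exact_mod_cast this
    have hN0 : (0 : ℝ) < N k := by
      have : 1 ≤ N k := by have := hq1 (4 * k); have := hN1 k; lia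
      exact_mod_cast this
    have h1 : (N k : ℝ) ≤ 2 * q (4 * k) := by have := hN2 k; exact_mod_cast this.le
    have h2 : Real.log (q (4 * k)) ≤ |B| * (4 * k) := by
      rcases Nat.eq_zero_or_pos k with rfl | hk
      · have : q (4 * 0) = 1 := by
          have h := hqd 0
          rw [contDen, GenContFract.zeroth_den_eq_one] at h
          exact_mod_cast h.symm
        rw [this]; simp
      · have h := hB ⟨⟨4 * k, by lia⟩, rfl⟩
        simp only [PNat.mk_coe, hqd] at h
        have h4 : (0 : ℝ) < ((4 * k : ℕ) : ℝ) := by positivity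
        rw [div_le_iff₀ h4] at h
        push_cast at h
        refine h.trans ?_
        gcongr
        exact le_abs_self B
    calc Real.log (N k) ≤ Real.log (2 * q (4 * k)) := Real.log_le_log hN0 h1
      _ = Real.log 2 + Real.log (q (4 * k)) := Real.log_mul (by norm_num) hq0.ne'
      _ ≤ 1 + |B| * (4 * k) := by linarith [Real.log_two_lt_d9]
      _ ≤ _ := by nlinarith [abs_nonneg B, (Nat.cast_nonneg k : (0 : ℝ) ≤ k)]

/-- A sequence `n` of times, with precision parameters `l`, that is sparse relative to `D`. -/
structure Schedule (D : ℕ) (n : ℕ → ℝ) (l : ℕ → ℕ) : Prop where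
  le_l : ∀ i, 13 ≤ l i
  mono_l : Monotone l
  le_n : ∀ i, (D : ℝ) ^ (19 * l i + 23) ≤ n i
  spacing : ∀ i, n i * (D : ℝ) ^ (52 * l (i + 1)) ≤ n (i + 1)
  growth : ∀ τ : ℝ, 0 < τ → ∃ C : ℝ, ∀ i,
    ∏ k ∈ Finset.range (i + 1), (D : ℝ) ^ (15 * l k + 21) ≤ C * n i ^ τ

/-- The word `W` has the right length to be steered at time `n i`. -/
def Due (D : ℕ) (n : ℕ → ℝ) (l : ℕ → ℕ) (W : Mob) (i : ℕ) : Prop :=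
  (D : ℝ) ^ (17 * l i + 20) * (W.c : ℝ) ^ 2 ≤ n i ∧
    n i ≤ (D : ℝ) ^ (17 * l i + 22) * (W.c : ℝ) ^ 2

/-- A choice of steering words for all due times. -/
structure Steering (U : Finset Mob) (D : ℕ) (n : ℕ → ℝ) (l : ℕ → ℕ) (δ : ℕ → ℝ)
    (v : Mob → Mob) : Prop where
  mem : ∀ W ∈ Adm.cl U, v W ∈ Adm.cl U
  c_le : ∀ W ∈ Adm.cl U, ∀ i, Due D n l W i →
    ((W * v W).c : ℝ) ≤ (D : ℝ) ^ (15 * l i + 21) * W.c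
  le_c : ∀ W ∈ Adm.cl U, ∀ i, Due D n l W i → n i ≤ ((W * v W).c : ℝ) ^ 2
  close : ∀ W ∈ Adm.cl U, ∀ i, Due D n l W i → ∀ t ∈ Icc (0 : ℝ) 1,
    ∃ z : ℤ, |n i * (W * v W).f t - δ i - z| ≤ 4 * (1 / 2) ^ l i
  idle : ∀ W ∈ Adm.cl U, (∀ i, ¬ Due D n l W i) → v W = 1

/-- The words along a branch with letters `u`. -/
def branch (v : Mob → Mob) (u : ℕ → Mob) : ℕ → Mob
  | 0 => 1
  | j + 1 => branch v u j * v (branch v u j) * u j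

lemma branch_congr (v : Mob → Mob) {u u' : ℕ → Mob} {j : ℕ} (h : ∀ i < j, u i = u' i) :
    branch v u j = branch v u' j := by
  induction j with
  | zero => rfl
  | succ j ih =>
    simp only [branch, ih fun i hi => h i (hi.trans j.lt_succ_self), h j j.lt_succ_self]

namespace Schedule

variable {U : Finset Mob} {D : ℕ} {n : ℕ → ℝ} {l : ℕ → ℕ}

lemma n_pos (hS : Schedule D n l) (hU : Adm U D) (i : ℕ) : 0 < n i :=
  lt_of_lt_of_le (pow_pos hU.D_pos _) (hS.le_n i)

lemma n_le_succ (hS : Schedule D n l) (hU : Adm U D) (i : ℕ) : n i ≤ n (i + 1) :=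
  (le_mul_of_one_le_right (hS.n_pos hU i).le (one_le_pow₀ hU.one_le_D)).trans (hS.spacing i)

lemma mono_n (hS : Schedule D n l) (hU : Adm U D) : Monotone n :=
  monotone_nat_of_le_succ (hS.n_le_succ hU)

lemma spacing_of_lt (hS : Schedule D n l) (hU : Adm U D) {i k : ℕ} (h : i < k) :
    n i * (D : ℝ) ^ (52 * l k) ≤ n k := by
  obtain ⟨k, rfl⟩ := Nat.exists_eq_succ_of_ne_zero (show k ≠ 0 by lia)
  refine le_trans ?_ (hS.spacing k)
  have := hU.D_pos
  gcongr
  exact hS.mono_n hU (by lia)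

lemma exists_lt (hS : Schedule D n l) (hU : Adm U D) (M : ℝ) : ∃ i, M < n i := by
  have h (i : ℕ) : (2 : ℝ) ^ i ≤ n i := by
    induction i with
    | zero => exact le_trans (by simpa using one_le_pow₀ hU.one_le_D) (hS.le_n 0)
    | succ i ih =>
      have h1 : (2 : ℝ) ≤ (D : ℝ) ^ (52 * l (i + 1)) :=
        (le_trans (by norm_num) hU.D_ge).trans
          (le_self_pow₀ hU.one_le_D (by have := hS.le_l (i + 1); lia))
      calc (2 : ℝ) ^ (i + 1) = 2 ^ i * 2 := pow_succ _ _
        _ ≤ n i * (D : ℝ) ^ (52 * l (i + 1)) := by gcongr; exact (hS.n_pos hU i).le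
        _ ≤ _ := hS.spacing i
  obtain ⟨i, hi⟩ := pow_unbounded_of_one_lt M (by norm_num : (1 : ℝ) < 2)
  exact ⟨i, hi.trans_le (h i)⟩

lemma le_of_due (hS : Schedule D n l) (hU : Adm U D) {W : Mob} {i k : ℕ} (hi : (W.c : ℝ) ^ 2 ≤ n i)
    (hk : Due D n l W k) : k ≤ i := by
  by_contra! h
  have h1 := hS.spacing_of_lt hU h
  have hc := W.c_pos
  have h2 : (D : ℝ) ^ (17 * l k + 22) < (D : ℝ) ^ (52 * l k) :=
    pow_lt_pow_right₀ (lt_of_lt_of_le (by norm_num) hU.D_ge) (by have := hS.le_l k; lia)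
  have h3 : (W.c : ℝ) ^ 2 * (D : ℝ) ^ (52 * l k) ≤ n i * (D : ℝ) ^ (52 * l k) := by
    have := hU.D_pos
    gcongr
  have h4 := hk.2
  have h5 : (D : ℝ) ^ (17 * l k + 22) * (W.c : ℝ) ^ 2 < (D : ℝ) ^ (52 * l k) * (W.c : ℝ) ^ 2 := by
    gcongr
  linarith

lemma sq_le_of_due (hU : Adm U D) {W : Mob} {i : ℕ} (h : Due D n l W i) :
    (W.c : ℝ) ^ 2 ≤ n i :=
  (le_mul_of_one_le_left (sq_nonneg _) (one_le_pow₀ hU.one_le_D)).trans h.1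

lemma due_unique (hS : Schedule D n l) (hU : Adm U D) {W : Mob} {i k : ℕ} (hi : Due D n l W i)
    (hk : Due D n l W k) : i = k :=
  le_antisymm (hS.le_of_due hU (sq_le_of_due hU hk) hi)
    (hS.le_of_due hU (sq_le_of_due hU hi) hk)

lemma exists_steering (hS : Schedule D n l) (hU : Adm U D) (δ : ℕ → ℝ) :
    ∃ v, Steering U D n l δ v := by
  have key : ∀ W : Mob, ∃ v : Mob, W ∈ Adm.cl U → v ∈ Adm.cl U ∧
      (∀ i, Due D n l W i → ((W * v).c : ℝ) ≤ (D : ℝ) ^ (15 * l i + 21) * W.c ∧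
        n i ≤ ((W * v).c : ℝ) ^ 2 ∧ ∀ t ∈ Icc (0 : ℝ) 1,
          ∃ z : ℤ, |n i * (W * v).f t - δ i - z| ≤ 4 * (1 / 2) ^ l i) ∧
      ((∀ i, ¬ Due D n l W i) → v = 1) := by
    intro W
    by_cases hW : W ∈ Adm.cl U
    swap
    · exact ⟨1, fun h => absurd h hW⟩
    by_cases hE : ∃ i, Due D n l W i
    · obtain ⟨i, hi⟩ := hE
      have hc : 2 * (D : ℝ) ^ l i ≤ W.c := by
        have h1 := (hS.le_n i).trans hi.2
        have hD := hU.D_pos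
        rw [show 19 * l i + 23 = (17 * l i + 22) + (2 * l i + 1) by ring, pow_add,
          mul_le_mul_iff_right₀ (by positivity)] at h1
        have h2 : (4 : ℝ) ≤ D := le_trans (by norm_num) hU.D_ge
        have h3 : (2 * (D : ℝ) ^ l i) ^ 2 ≤ (D : ℝ) ^ (2 * l i + 1) := by
          rw [mul_pow, ← pow_mul, pow_succ (D : ℝ), mul_comm (l i)]
          have : (0 : ℝ) < (D : ℝ) ^ (2 * l i) := by positivity
          nlinarith
        exact (pow_le_pow_iff_left₀ (by positivity) W.c_pos.le two_ne_zero).1 (h3.trans h1)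
      obtain ⟨v, hv, h1, h2, h3⟩ := hU.exists_forced hW (hS.le_l i) hc hi.1 hi.2 (δ i)
      refine ⟨v, fun _ => ⟨hv, fun k hk => ?_, fun h => absurd hi (h i)⟩⟩
      obtain rfl := hS.due_unique hU hi hk
      exact ⟨h1, h2, h3⟩
    · push Not at hE
      exact ⟨1, fun _ => ⟨one_mem _, fun i hi => absurd hi (hE i), fun _ => rfl⟩⟩
  choose v hv using key
  exact ⟨v, fun W hW => (hv W hW).1, fun W hW i hi => ((hv W hW).2.1 i hi).1,
    fun W hW i hi => ((hv W hW).2.1 i hi).2.1, fun W hW i hi => ((hv W hW).2.1 i hi).2.2,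
    fun W hW => (hv W hW).2.2⟩

end Schedule

namespace Steering

variable {U : Finset Mob} {D : ℕ} {n : ℕ → ℝ} {l : ℕ → ℕ} {δ : ℕ → ℝ} {v : Mob → Mob}
  {u : ℕ → Mob}

lemma branch_mem (hv : Steering U D n l δ v) (hu : ∀ i, u i ∈ U) (j : ℕ) :
    branch v u j ∈ Adm.cl U := by
  induction j with
  | zero => exact one_mem _
  | succ j ih => exact mul_mem (mul_mem ih (hv.mem _ ih)) (Submonoid.subset_closure (hu j))

lemma branch_succ_c_le (hU : Adm U D) (hu : ∀ i, u i ∈ U) (j : ℕ) :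
    ((branch v u (j + 1)).c : ℝ) ≤ D * (branch v u j * v (branch v u j)).c := by
  have h1 := hU.le_D _ (hu j)
  have h2 := (branch v u j * v (branch v u j)).c_pos
  refine (Mob.c_mul_le _ _).trans ?_
  nlinarith

lemma branch_c_le_succ (v : Mob → Mob) (u : ℕ → Mob) (j : ℕ) :
    ((branch v u j).c : ℝ) ≤ (branch v u (j + 1)).c :=
  (Mob.c_le_mul_left _ _).trans (Mob.c_le_mul_left _ _)

lemma two_pow_le_branch_c (hU : Adm U D) (hu : ∀ i, u i ∈ U) (j : ℕ) :
    (2 : ℝ) ^ j ≤ (branch v u j).c := by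
  induction j with
  | zero => exact_mod_cast (1 : Mob).c_ge
  | succ j ih =>
    calc (2 : ℝ) ^ (j + 1) = 2 ^ j * 2 := pow_succ _ _
      _ ≤ (branch v u j * v (branch v u j)).c * (u j).c := by
        have := (branch v u j * v (branch v u j)).c_pos
        exact mul_le_mul (ih.trans (Mob.c_le_mul_left _ _)) (hU.two_le _ (hu j)) (by norm_num)
          this.le
      _ ≤ _ := Mob.le_c_mul _ _

lemma one_c : ((1 : Mob).c : ℝ) = 1 := by simp

lemma exists_due (hv : Steering U D n l δ v) (hU : Adm U D) (hS : Schedule D n l)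
    (hu : ∀ i, u i ∈ U) (i : ℕ) : ∃ j, Due D n l (branch v u j) i := by
  classical
  have hD := hU.D_pos
  have hD1 := hU.one_le_D
  have hex : ∃ j, n i < (D : ℝ) ^ (17 * l i + 20) * ((branch v u j).c : ℝ) ^ 2 := by
    obtain ⟨j, hj⟩ := pow_unbounded_of_one_lt (n i) (by norm_num : (1 : ℝ) < 2)
    refine ⟨j, hj.trans_le ?_⟩
    have h1 := two_pow_le_branch_c (v := v) hU hu j
    have h2 := (branch v u j).c_ge
    calc (2 : ℝ) ^ j ≤ 1 * ((branch v u j).c : ℝ) ^ 2 := by nlinarith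
      _ ≤ _ := by gcongr; exact one_le_pow₀ hD1
  obtain ⟨j, hj, hmin⟩ : ∃ j, n i < (D : ℝ) ^ (17 * l i + 20) * ((branch v u (j + 1)).c : ℝ) ^ 2 ∧
      (D : ℝ) ^ (17 * l i + 20) * ((branch v u j).c : ℝ) ^ 2 ≤ n i := by
    obtain ⟨j, hj⟩ : ∃ j, Nat.find hex = j + 1 := by
      apply Nat.exists_eq_succ_of_ne_zero
      intro h0
      have h1 := Nat.find_spec hex
      rw [h0] at h1
      have h2 := hS.le_n i
      simp only [branch, one_c, one_pow, mul_one] at h1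
      have h3 : (D : ℝ) ^ (17 * l i + 20) ≤ (D : ℝ) ^ (19 * l i + 23) :=
        pow_le_pow_right₀ hD1 (by lia)
      linarith
    exact ⟨j, hj ▸ Nat.find_spec hex, not_lt.1 (Nat.find_min hex (by lia))⟩
  refine ⟨j, hmin, ?_⟩
  set W := branch v u j with hW
  have hWm : W ∈ Adm.cl U := hv.branch_mem hu j
  have hc := W.c_pos
  have hsucc := branch_succ_c_le (v := v) hU hu j
  rw [← hW] at hsucc
  have hsq : (W.c : ℝ) ^ 2 ≤ n i :=
    (le_mul_of_one_le_left (sq_nonneg _) (one_le_pow₀ hD1)).trans hmin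
  by_cases hE : ∃ k, Due D n l W k
  · obtain ⟨k, hk⟩ := hE
    rcases (hS.le_of_due hU hsq hk).eq_or_lt with rfl | hlt
    · exact hk.2
    exfalso
    have hl : l k ≤ l i := hS.mono_l hlt.le
    have h13 := hS.le_l i
    have h1 := hS.spacing_of_lt hU hlt
    have h2 := Schedule.sq_le_of_due hU hk
    have h3 : ((branch v u (j + 1)).c : ℝ) ≤ (D : ℝ) ^ (15 * l i + 22) * W.c := by
      calc ((branch v u (j + 1)).c : ℝ) ≤ D * ((D : ℝ) ^ (15 * l k + 21) * W.c) :=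
            hsucc.trans (by gcongr; exact hv.c_le W hWm k hk)
        _ = (D : ℝ) ^ (15 * l k + 22) * W.c := by ring
        _ ≤ _ := by gcongr
    have hc' := (branch v u (j + 1)).c_pos
    have h4 : (D : ℝ) ^ (17 * l i + 20) * ((branch v u (j + 1)).c : ℝ) ^ 2 ≤
        n k * (D : ℝ) ^ (52 * l i) := by
      calc (D : ℝ) ^ (17 * l i + 20) * ((branch v u (j + 1)).c : ℝ) ^ 2
          ≤ (D : ℝ) ^ (17 * l i + 20) * ((D : ℝ) ^ (15 * l i + 22) * W.c) ^ 2 := by gcongr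
        _ = (W.c : ℝ) ^ 2 * (D : ℝ) ^ (47 * l i + 64) := by ring
        _ ≤ n k * (D : ℝ) ^ (52 * l i) := by
          gcongr
          · exact (hS.n_pos hU k).le
          · lia
    linarith
  · push Not at hE
    have h1 := hv.idle W hWm hE
    rw [h1, mul_one] at hsucc
    have hc' := (branch v u (j + 1)).c_pos
    calc n i ≤ (D : ℝ) ^ (17 * l i + 20) * ((branch v u (j + 1)).c : ℝ) ^ 2 := hj.le
      _ ≤ (D : ℝ) ^ (17 * l i + 20) * (D * W.c) ^ 2 := by gcongr
      _ = _ := by ring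

lemma branch_c_le_of_sq_lt (hv : Steering U D n l δ v) (hU : Adm U D) (hS : Schedule D n l)
    (hu : ∀ i, u i ∈ U) (j i : ℕ) (h : ((branch v u j).c : ℝ) ^ 2 < n i) :
    ((branch v u j).c : ℝ) ≤
      (D : ℝ) ^ j * ∏ k ∈ Finset.range i, (D : ℝ) ^ (15 * l k + 21) := by
  have hD := hU.D_pos
  have hD1 := hU.one_le_D
  have hone : ∀ k, (1 : ℝ) ≤ (D : ℝ) ^ (15 * l k + 21) := fun k => one_le_pow₀ hD1
  induction j generalizing i with
  | zero =>
    simp only [branch, one_c, pow_zero, one_mul]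
    exact Finset.one_le_prod fun k _ => hone k
  | succ j ih =>
    have hle := branch_c_le_succ v u j
    have hsucc := branch_succ_c_le (v := v) hU hu j
    have hWm := hv.branch_mem hu j
    have hPle : ((branch v u j * v (branch v u j)).c : ℝ) ≤ (branch v u (j + 1)).c :=
      Mob.c_le_mul_left _ _
    set W := branch v u j
    have hc := W.c_pos
    by_cases hE : ∃ k, Due D n l W k
    · obtain ⟨k, hk⟩ := hE
      have hP := (W * v W).c_pos
      have h1 : n k < n i := lt_of_le_of_lt ((hv.le_c W hWm k hk).trans (by gcongr)) h
      have hki : k < i := (hS.mono_n hU).reflect_lt h1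
      have h2 : (W.c : ℝ) ^ 2 < n k := by
        refine lt_of_lt_of_le ?_ hk.1
        have : (1 : ℝ) < (D : ℝ) ^ (17 * l k + 20) :=
          one_lt_pow₀ (lt_of_lt_of_le (by norm_num) hU.D_ge) (by lia)
        exact lt_mul_of_one_lt_left (by positivity) this
      have h3 := ih k h2
      calc ((branch v u (j + 1)).c : ℝ) ≤ D * ((D : ℝ) ^ (15 * l k + 21) * W.c) :=
            hsucc.trans (by gcongr; exact hv.c_le W hWm k hk)
        _ ≤ D * ((D : ℝ) ^ (15 * l k + 21) *
            ((D : ℝ) ^ j * ∏ k ∈ Finset.range k, (D : ℝ) ^ (15 * l k + 21))) := by gcongr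
        _ = (D : ℝ) ^ (j + 1) * ∏ k ∈ Finset.range (k + 1), (D : ℝ) ^ (15 * l k + 21) := by
            rw [Finset.prod_range_succ]; ring
        _ ≤ _ := by
            gcongr ?_ * ?_
            exact Finset.prod_le_prod_of_subset_of_one_le (Finset.range_mono hki)
              (fun k _ => zero_le_one.trans (hone k)) fun k _ _ => hone k
    · push Not at hE
      have h1 := hv.idle W hWm hE
      rw [h1, mul_one] at hsucc
      have h2 := ih i (lt_of_le_of_lt (by gcongr) h)
      calc ((branch v u (j + 1)).c : ℝ) ≤ D * W.c := hsucc
        _ ≤ D * ((D : ℝ) ^ j * ∏ k ∈ Finset.range i, (D : ℝ) ^ (15 * l k + 21)) := by gcongr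
        _ = _ := by rw [pow_succ]; ring

lemma exists_branch_c_rpow_le (hv : Steering U D n l δ v) (hU : Adm U D) (hS : Schedule D n l)
    {τ : ℝ} (hτ : 0 < τ) : ∃ C : ℝ, 1 ≤ C ∧ ∀ u : ℕ → Mob, (∀ i, u i ∈ U) → ∀ j,
      ((branch v u j).c : ℝ) ≤ C * (D : ℝ) ^ j * ((branch v u j).c : ℝ) ^ (2 * τ) := by
  classical
  obtain ⟨C, hC⟩ := hS.growth τ hτ
  refine ⟨max C 1, le_max_right _ _, fun u hu j => ?_⟩
  have hD := hU.D_pos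
  have hex := hS.exists_lt hU (((branch v u j).c : ℝ) ^ 2)
  have h1 := hv.branch_c_le_of_sq_lt hU hS hu j _ (Nat.find_spec hex)
  have hc1 := (branch v u j).c_ge
  have hrp : (1 : ℝ) ≤ ((branch v u j).c : ℝ) ^ (2 * τ) := Real.one_le_rpow hc1 (by positivity)
  rcases Nat.eq_zero_or_pos (Nat.find hex) with h0 | hpos
  · rw [h0] at h1
    simp only [Finset.range_zero, Finset.prod_empty, mul_one] at h1
    calc ((branch v u j).c : ℝ) ≤ 1 * (D : ℝ) ^ j * 1 := by simpa using h1
      _ ≤ _ := by gcongr; exact le_max_right _ _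
  · obtain ⟨i, hi⟩ := Nat.exists_eq_succ_of_ne_zero hpos.ne'
    rw [hi] at h1
    have h2 : n i ≤ ((branch v u j).c : ℝ) ^ 2 := not_lt.1 (Nat.find_min hex (by lia))
    have hn := hS.n_pos hU i
    calc ((branch v u j).c : ℝ) ≤ (D : ℝ) ^ j * (C * n i ^ τ) :=
          h1.trans (by gcongr; exact hC i)
      _ ≤ (D : ℝ) ^ j * (max C 1 * (((branch v u j).c : ℝ) ^ 2) ^ τ) := by
          gcongr; exact le_max_left _ _
      _ = _ := by
          rw [← Real.rpow_natCast _ 2, ← Real.rpow_mul (by positivity)]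
          push_cast; ring

end Steering

lemma Mob.continuousOn_f (g : Mob) : ContinuousOn g.f (Icc 0 1) := by
  unfold Mob.f
  refine ContinuousOn.div (by fun_prop) (by fun_prop) fun t ht => (g.den_pos ht.1).ne'

lemma exists_branch_limit (v : Mob → Mob) (u : ℕ → Mob) :
    ∃ x : ℝ, ∀ j, ∃ t ∈ Icc (0 : ℝ) 1, x = (branch v u j).f t := by
  have hcpt : ∀ j, IsCompact ((branch v u j).f '' Icc (0 : ℝ) 1) := fun j =>
    isCompact_Icc.image_of_continuousOn (Mob.continuousOn_f _)
  have hnest : ∀ j, (branch v u (j + 1)).f '' Icc (0 : ℝ) 1 ⊆ (branch v u j).f '' Icc (0 : ℝ) 1 := by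
    rintro j _ ⟨t, ht, rfl⟩
    refine ⟨(v (branch v u j) * u j).f t, Mob.f_mem _ ht, ?_⟩
    rw [← Mob.f_mul _ _ ht.1, ← mul_assoc]
    rfl
  obtain ⟨x, hx⟩ := IsCompact.nonempty_iInter_of_sequence_nonempty_isCompact_isClosed
    (fun j => (branch v u j).f '' Icc (0 : ℝ) 1) hnest
    (fun j => (nonempty_Icc.2 zero_le_one).image _) (hcpt 0) (fun j => (hcpt j).isClosed)
  refine ⟨x, fun j => ?_⟩
  obtain ⟨t, ht, h⟩ := mem_iInter.1 hx j
  exact ⟨t, ht, h.symm⟩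

/-- A point in all the intervals along a branch. -/
noncomputable def branchLimit (v : Mob → Mob) (u : ℕ → Mob) : ℝ := (exists_branch_limit v u).choose

lemma branchLimit_spec (v : Mob → Mob) (u : ℕ → Mob) (j : ℕ) :
    ∃ t ∈ Icc (0 : ℝ) 1, branchLimit v u = (branch v u j).f t :=
  (exists_branch_limit v u).choose_spec j

lemma branchLimit_spec_letter (v : Mob → Mob) (u : ℕ → Mob) (j : ℕ) :
    ∃ t ∈ Icc (0 : ℝ) 1,
      branchLimit v u = (branch v u j * v (branch v u j)).f ((u j).f t) := by
  obtain ⟨t, ht, h⟩ := branchLimit_spec v u (j + 1)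
  exact ⟨t, ht, by rw [h, branch, Mob.f_mul _ _ ht.1]⟩

namespace Steering

variable {U : Finset Mob} {D : ℕ} {n : ℕ → ℝ} {l : ℕ → ℕ} {δ : ℕ → ℝ} {v : Mob → Mob}
  {u : ℕ → Mob}

lemma branchLimit_mem_bad (hv : Steering U D n l δ v) (hU : Adm U D) (hu : ∀ i, u i ∈ U) :
    branchLimit v u ∈ Bad := by
  refine hU.mem_bad fun M => ?_
  obtain ⟨j, hj⟩ := pow_unbounded_of_one_lt M (by norm_num : (1 : ℝ) < 2)
  exact ⟨_, hv.branch_mem hu j, hj.le.trans (two_pow_le_branch_c hU hu j), branchLimit_spec v u j⟩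

lemma branchLimit_close (hv : Steering U D n l δ v) (hU : Adm U D) (hS : Schedule D n l)
    (hu : ∀ i, u i ∈ U) (i : ℕ) :
    ∃ z : ℤ, |n i * branchLimit v u - δ i - z| ≤ 4 * (1 / 2) ^ l i := by
  obtain ⟨j, hj⟩ := hv.exists_due hU hS hu i
  obtain ⟨t, ht, h⟩ := branchLimit_spec_letter v u j
  rw [h]
  exact hv.close _ (hv.branch_mem hu j) i hj _ (Mob.f_mem _ ht)

lemma exists_holder_bound (hv : Steering U D n l δ v) (hU : Adm U D) (hS : Schedule D n l)
    {s s' : ℝ} (hs : 0 < s) (hss : s < s') (hcard : (D : ℝ) ^ (2 * s') ≤ U.card) :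
    ∃ C : ℝ, 0 < C ∧ ∀ u u' : ℕ → Mob, (∀ i, u i ∈ U) → (∀ i, u' i ∈ U) → ∀ j,
      (∀ i < j, u i = u' i) → u j ≠ u' j →
        ((U.card : ℝ) ^ j)⁻¹ ≤ C * |branchLimit v u - branchLimit v u'| ^ s := by
  have hs' : 0 < s' := hs.trans hss
  have hD := hU.D_pos
  have hb : (0 : ℝ) < U.card := by exact_mod_cast hU.nonempty.card_pos
  obtain ⟨C, hC1, hC⟩ := hv.exists_branch_c_rpow_le hU hS (τ := (1 - s / s') / 2)
    (by have := (div_lt_one hs').2 hss; linarith)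
  have hC0 : 0 < C := by linarith
  refine ⟨(4 * (D : ℝ) ^ 2) ^ s * ((C * D) ^ (2 * s')), by positivity,
    fun u u' hu hu' j hagree hne => ?_⟩
  obtain ⟨t, ht, hx⟩ := branchLimit_spec_letter v u j
  obtain ⟨t', ht', hx'⟩ := branchLimit_spec_letter v u' j
  rw [← branch_congr v hagree] at hx'
  set P := branch v u j * v (branch v u j) with hP
  set c : ℝ := ((branch v u (j + 1)).c : ℝ) with hc
  have hc0 : 0 < c := Mob.c_pos _
  have hPc : (P.c : ℝ) ≤ c := Mob.c_le_mul_left _ _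
  have hP0 := P.c_pos
  set Δ := |branchLimit v u - branchLimit v u'| with hΔ
  have h1 : 1 ≤ 4 * (D : ℝ) ^ 2 * c ^ 2 * Δ := by
    have h2 := P.le_abs_f_sub ((u j).f_mem ht) ((u' j).f_mem ht')
    rw [← hx, ← hx', ← hΔ, div_le_iff₀ (by positivity)] at h2
    have h3 := (hU.sep _ (hu j) _ (hu' j) hne t ht t' ht').trans h2
    rw [div_le_iff₀ (by positivity)] at h3
    calc (1 : ℝ) ≤ Δ * (4 * (P.c : ℝ) ^ 2) * (D : ℝ) ^ 2 := h3
      _ ≤ Δ * (4 * c ^ 2) * (D : ℝ) ^ 2 := by gcongr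
      _ = _ := by ring
  have hcs : c ^ (s / s') ≤ C * (D : ℝ) ^ (j + 1) := by
    have h2 := hC u hu (j + 1)
    rw [← hc, show 2 * ((1 - s / s') / 2) = 1 - s / s' by ring] at h2
    have h3 : c ^ (s / s') * c ^ (1 - s / s') = c := by
      rw [← Real.rpow_add hc0]; simp
    have h4 : 0 < c ^ (1 - s / s') := by positivity
    rw [← mul_le_mul_iff_left₀ h4, h3]
    exact h2
  have hcb : (c ^ 2) ^ s ≤ (C * D) ^ (2 * s') * (U.card : ℝ) ^ j := by
    calc (c ^ 2) ^ s = (c ^ (s / s')) ^ (2 * s') := by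
          rw [← Real.rpow_natCast c 2, ← Real.rpow_mul hc0.le, ← Real.rpow_mul hc0.le]
          congr 1
          push_cast
          field_simp
      _ ≤ (C * (D : ℝ) ^ (j + 1)) ^ (2 * s') := by gcongr
      _ = (C * D) ^ (2 * s') * ((D : ℝ) ^ (2 * s')) ^ j := by
          rw [pow_succ', ← mul_assoc, Real.mul_rpow (by positivity) (by positivity),
            ← Real.rpow_natCast, ← Real.rpow_mul hD.le, ← Real.rpow_natCast,
            ← Real.rpow_mul hD.le, mul_comm (j : ℝ)]
      _ ≤ _ := by gcongr
  rw [inv_le_iff_one_le_mul₀ (by positivity)]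
  have hΔ0 : 0 ≤ Δ := abs_nonneg _
  calc (1 : ℝ) ≤ (4 * (D : ℝ) ^ 2 * c ^ 2 * Δ) ^ s := Real.one_le_rpow h1 hs.le
    _ = (4 * (D : ℝ) ^ 2) ^ s * (c ^ 2) ^ s * Δ ^ s := by
        rw [Real.mul_rpow (by positivity) hΔ0, Real.mul_rpow (by positivity) (by positivity)]
    _ ≤ (4 * (D : ℝ) ^ 2) ^ s * ((C * D) ^ (2 * s') * (U.card : ℝ) ^ j) * Δ ^ s := by gcongr
    _ = _ := by ring

end Steering

lemma Adm.exists_set {U : Finset Mob} {D : ℕ} (hU : Adm U D) {n : ℕ → ℝ} {l : ℕ → ℕ}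
    (hS : Schedule D n l) (δ : ℕ → ℝ) {s s' : ℝ} (hs : 0 < s) (hss : s < s')
    (hcard : (D : ℝ) ^ (2 * s') ≤ U.card) :
    ∃ G ⊆ Bad, ENNReal.ofReal s ≤ dimH G ∧
      ∀ β ∈ G, ∀ i, ∃ z : ℤ, |n i * β - δ i - z| ≤ 4 * (1 / 2) ^ l i := by
  classical
  obtain ⟨v, hv⟩ := hS.exists_steering hU δ
  obtain ⟨C, hC0, hC⟩ := hv.exists_holder_bound hU hS hs hss hcard
  set u : (ℕ → Fin U.card) → ℕ → Mob := fun σ i => U.equivFin.symm (σ i) with hu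
  have hmem : ∀ σ i, u σ i ∈ U := fun σ i => (U.equivFin.symm (σ i)).2
  have hfirst : ∀ σ σ' : ℕ → Fin U.card, σ ≠ σ' →
      ∃ j, (∀ i < j, σ i = σ' i) ∧ σ j ≠ σ' j := by
    intro σ σ' h
    have hex := Function.ne_iff.1 h
    exact ⟨Nat.find hex, fun i hi => not_not.1 (Nat.find_min hex hi), Nat.find_spec hex⟩
  set X : (ℕ → Fin U.card) → ℝ := fun σ => branchLimit v (u σ) with hX
  have hdist : ∀ σ σ' j, (∀ i < j, σ i = σ' i) → σ j ≠ σ' j →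
      ((U.card : ℝ) ^ j)⁻¹ ≤ C * |X σ - X σ'| ^ s := by
    intro σ σ' j h hne
    refine hC _ _ (hmem σ) (hmem σ') j (fun i hi => by simp only [hu, h i hi]) fun heq => hne ?_
    exact U.equivFin.symm.injective (Subtype.ext heq)
  have hb : (0 : ℝ) < U.card := by exact_mod_cast hU.nonempty.card_pos
  have hinj : Function.Injective X := by
    intro σ σ' h
    by_contra hne
    obtain ⟨j, h1, h2⟩ := hfirst σ σ' hne
    have h3 := hdist σ σ' j h1 h2
    rw [h, sub_self, abs_zero, Real.zero_rpow hs.ne', mul_zero] at h3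
    have : 0 < ((U.card : ℝ) ^ j)⁻¹ := by positivity
    linarith
  have : Nonempty (Fin U.card) := ⟨⟨0, hU.nonempty.card_pos⟩⟩
  set φ : ℝ → ℝ := fun y => Real.ofDigits (Function.invFun X y) with hφ
  have hφX : ∀ σ, φ (X σ) = Real.ofDigits σ := fun σ => by
    simp only [hφ, Function.leftInverse_invFun hinj σ]
  have hhol : HolderOnWith C.toNNReal s.toNNReal φ (range X) := by
    rintro _ ⟨σ, rfl⟩ _ ⟨σ', rfl⟩
    rw [hφX, hφX]
    by_cases hσ : σ = σ'
    · subst hσ; simp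
    obtain ⟨j, h1, h2⟩ := hfirst σ σ' hσ
    have h3 := (Real.abs_ofDigits_sub_ofDigits_le h1).trans (hdist σ σ' j h1 h2)
    rw [edist_dist, edist_dist, Real.dist_eq, Real.dist_eq, Real.coe_toNNReal s hs.le,
      ENNReal.ofReal_rpow_of_nonneg (abs_nonneg _) hs.le]
    refine (ENNReal.ofReal_le_ofReal h3).trans ?_
    rw [ENNReal.ofReal_mul hC0.le]
    rfl
  refine ⟨range X, ?_, ?_, ?_⟩
  · rintro _ ⟨σ, rfl⟩
    exact hv.branchLimit_mem_bad hU (hmem σ)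
  · have hsurj : Icc (0 : ℝ) 1 ⊆ φ '' range X := fun y hy => by
      obtain ⟨σ, -, h⟩ := Real.ofDigits_SurjOn (b := U.card) hU.two_le_card hy
      exact ⟨X σ, ⟨σ, rfl⟩, by rw [hφX, h]⟩
    have h1 : dimH (Icc (0 : ℝ) 1) = 1 := by
      rw [Real.dimH_of_nonempty_interior (by simp)]
      simp
    have h2 := (dimH_mono hsurj).trans (hhol.dimH_image_le (by simpa using hs))
    rw [h1, ENNReal.le_div_iff_mul_le (by simp [hs]) (by simp), one_mul] at h2
    exact h2
  · rintro _ ⟨σ, rfl⟩ i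
    exact hv.branchLimit_close hU hS (hmem σ) i

/-- The precision parameter of the `e`-th event. -/
def evL (e : ℕ) : ℕ := Nat.log 2 e + 1

/-- The index of the time of the `e`-th event. -/
def evK (e : ℕ) : ℕ := e * evL e ^ 2

lemma evL_mono : Monotone evL := fun _ _ h => Nat.succ_le_succ (Nat.log_mono_right h)

lemma lt_two_pow_evL (e : ℕ) : e < 2 ^ evL e := Nat.lt_pow_succ_log_self (by norm_num) e

lemma le_evL {L e : ℕ} (h : 2 ^ L ≤ e) : L ≤ evL e :=
  (Nat.le_log_of_pow_le (by norm_num) h).trans (Nat.le_succ _)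

lemma evK_add_le (e : ℕ) : evK e + evL (e + 1) ^ 2 ≤ evK (e + 1) := by
  unfold evK
  have : e * evL e ^ 2 ≤ e * evL (e + 1) ^ 2 := by gcongr; exact evL_mono (Nat.le_succ e)
  lia

lemma le_evK (e : ℕ) : e ≤ evK e := Nat.le_mul_of_pos_right _ (pow_pos (Nat.succ_pos _) _)

lemma two_pow_mul_le {N : ℕ → ℕ} (h2 : ∀ k, 2 * N k ≤ N (k + 1)) (k m : ℕ) :
    2 ^ m * N k ≤ N (k + m) := by
  induction m with
  | zero => simp
  | succ m ih =>
    have := h2 (k + m)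
    rw [pow_succ, ← add_assoc]
    lia

lemma two_pow_le {N : ℕ → ℕ} (h1 : ∀ k, 1 ≤ N k) (h2 : ∀ k, 2 * N k ≤ N (k + 1)) (k : ℕ) :
    2 ^ k ≤ N k := by
  have h := two_pow_mul_le h2 0 k
  rw [zero_add] at h
  exact (Nat.le_mul_of_pos_right _ (h1 0)).trans h

lemma exists_schedule {N : ℕ → ℕ} (h1 : ∀ k, 1 ≤ N k) (h2 : ∀ k, 2 * N k ≤ N (k + 1)) {D : ℕ}
    (hD : 1 ≤ D) :
    ∃ e₀, Schedule D (fun i => (N (evK (e₀ + i)) : ℝ)) (fun i => evL (e₀ + i)) := by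
  have hD2 : D ≤ 2 ^ D := Nat.lt_two_pow_self.le
  have hpow (m : ℕ) : D ^ m ≤ 2 ^ (D * m) := by
    rw [pow_mul]; gcongr
  have hL (i : ℕ) : 52 * D + 13 ≤ evL (2 ^ (52 * D + 13) + i) := le_evL (Nat.le_add_right _ _)
  refine ⟨2 ^ (52 * D + 13), fun i => ?_, fun i j h => evL_mono (by lia), fun i => ?_, fun i => ?_,
    fun τ hτ => ?_⟩
  · have := hL i; lia
  · have hLi := hL i
    have he : 52 * D ≤ 2 ^ (52 * D + 13) + i := by
      have : 52 * D + 13 < 2 ^ (52 * D + 13) := Nat.lt_two_pow_self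
      lia
    set e := 2 ^ (52 * D + 13) + i
    have : D ^ (19 * evL e + 23) ≤ N (evK e) := by
      refine ((hpow _).trans (Nat.pow_le_pow_right (by norm_num) ?_)).trans (two_pow_le h1 h2 _)
      calc D * (19 * evL e + 23) ≤ 52 * D * evL e := by nlinarith
        _ ≤ e * evL e ^ 2 := by
          refine Nat.mul_le_mul he ?_
          nlinarith
    exact_mod_cast this
  · have hLi := hL (i + 1)
    rw [← add_assoc] at hLi ⊢
    set e := 2 ^ (52 * D + 13) + i
    have : N (evK e) * D ^ (52 * evL (e + 1)) ≤ N (evK (e + 1)) := by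
      have h3 := two_pow_mul_le h2 (evK e) (evK (e + 1) - evK e)
      have h4 := evK_add_le e
      rw [Nat.add_sub_cancel' (by lia), mul_comm] at h3
      refine le_trans ?_ h3
      refine Nat.mul_le_mul_left _ ?_
      refine (hpow _).trans (Nat.pow_le_pow_right (by norm_num) ?_)
      have : D * (52 * evL (e + 1)) ≤ evL (e + 1) ^ 2 := by nlinarith
      lia
    exact_mod_cast this
  · obtain ⟨L, hLτ⟩ := exists_nat_gt (72 * D / τ)
    refine ⟨2 ^ (72 * D * (2 ^ L * L)), fun i => ?_⟩
    have hLi := hL i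
    have hi : i + 1 ≤ 2 ^ (52 * D + 13) + i := by
      have := Nat.one_le_two_pow (n := 52 * D + 13)
      lia
    have hprod : ∏ k ∈ Finset.range (i + 1), (D : ℝ) ^ (15 * evL (2 ^ (52 * D + 13) + k) + 21) ≤
        2 ^ (72 * D * ((2 ^ (52 * D + 13) + i) * evL (2 ^ (52 * D + 13) + i))) := by
      set e := 2 ^ (52 * D + 13) + i with he
      have hD1 : (1 : ℝ) ≤ D := by exact_mod_cast hD
      calc ∏ k ∈ Finset.range (i + 1), (D : ℝ) ^ (15 * evL (2 ^ (52 * D + 13) + k) + 21)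
          ≤ ∏ k ∈ Finset.range (i + 1), (D : ℝ) ^ (36 * evL e) := by
            refine Finset.prod_le_prod (fun k _ => by positivity) fun k hk => ?_
            have hk' : evL (2 ^ (52 * D + 13) + k) ≤ evL e :=
              evL_mono (by have := Finset.mem_range.1 hk; lia)
            exact pow_le_pow_right₀ hD1 (by lia)
        _ = (D : ℝ) ^ (36 * evL e * (i + 1)) := by simp [pow_mul]
        _ ≤ 2 ^ (D * (36 * evL e * (i + 1))) := by exact_mod_cast hpow _
        _ ≤ _ := by
            refine pow_le_pow_right₀ (by norm_num) ?_
            calc D * (36 * evL e * (i + 1)) ≤ D * (36 * evL e * e) := by gcongr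
              _ ≤ _ := by nlinarith [Nat.zero_le (D * (evL e * e))]
    refine hprod.trans ?_
    set e := 2 ^ (52 * D + 13) + i
    have hN : (2 : ℝ) ^ evK e ≤ N (evK e) := by exact_mod_cast two_pow_le h1 h2 _
    have hone : (1 : ℝ) ≤ (N (evK e) : ℝ) ^ τ :=
      Real.one_le_rpow (by exact_mod_cast h1 _) hτ.le
    rcases le_total (evL e) L with hle | hle
    · have he : e ≤ 2 ^ L := (lt_two_pow_evL e).le.trans (Nat.pow_le_pow_right (by norm_num) hle)
      calc (2 : ℝ) ^ (72 * D * (e * evL e)) ≤ 2 ^ (72 * D * (2 ^ L * L)) := by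
            refine pow_le_pow_right₀ (by norm_num) ?_
            gcongr
        _ ≤ _ := le_mul_of_one_le_right (by positivity) hone
    · have h3 : (72 * D : ℝ) ≤ τ * evL e := by
        have : (L : ℝ) ≤ evL e := by exact_mod_cast hle
        rw [div_lt_iff₀ hτ] at hLτ
        nlinarith
      calc (2 : ℝ) ^ (72 * D * (e * evL e)) = 2 ^ ((72 * D : ℝ) * (e * evL e)) := by
            rw [← Real.rpow_natCast]; push_cast; rfl
        _ ≤ 2 ^ ((τ * evL e) * ((e : ℝ) * evL e)) := by
            refine Real.rpow_le_rpow_of_exponent_le (by norm_num) ?_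
            gcongr
        _ = ((2 : ℝ) ^ evK e) ^ τ := by
            rw [← Real.rpow_natCast, ← Real.rpow_mul (by norm_num)]
            congr 1
            unfold evK
            push_cast
            ring
        _ ≤ (N (evK e) : ℝ) ^ τ := by gcongr
        _ ≤ _ := le_mul_of_one_le_left (by positivity) (one_le_pow₀ (by norm_num))

/-- Steering all large events simultaneously on a set of full dimension. -/
lemma exists_full_dim_set {N : ℕ → ℕ} (h1 : ∀ k, 1 ≤ N k) (h2 : ∀ k, 2 * N k ≤ N (k + 1))
    (δ : ℕ → ℝ) : ∃ G ⊆ Bad, dimH G = 1 ∧ ∀ β ∈ G, ∃ e₀, ∀ e ≥ e₀, ∃ z : ℤ,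
      |N (evK e) * β - δ e - z| ≤ 4 * (1 / 2) ^ evL e := by
  have key (s : ℝ) (hs : 0 < s) (hs1 : s < 1) : ∃ G ⊆ Bad, ENNReal.ofReal s ≤ dimH G ∧ ∀ β ∈ G,
      ∃ e₀, ∀ e ≥ e₀, ∃ z : ℤ, |N (evK e) * β - δ e - z| ≤ 4 * (1 / 2) ^ evL e := by
    obtain ⟨U, D, hU, hcard⟩ := Adm.exists_adm (s := (1 + s) / 2) (by linarith)
    obtain ⟨e₀, hS⟩ := exists_schedule h1 h2 (D := D) (by exact_mod_cast hU.one_le_D)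
    obtain ⟨G, hG, hdim, hclose⟩ := hU.exists_set hS (fun i => δ (e₀ + i)) hs
      (by linarith : s < (1 + s) / 2) hcard
    refine ⟨G, hG, hdim, fun β hβ => ⟨e₀, fun e he => ?_⟩⟩
    have := hclose β hβ (e - e₀)
    simpa only [Nat.add_sub_cancel' he] using this
  have hpos (m : ℕ) : 0 < 1 - 1 / ((m : ℝ) + 2) := by
    rw [sub_pos, div_lt_one (by positivity)]
    linarith [(Nat.cast_nonneg m : (0 : ℝ) ≤ m)]
  choose G hG hdim hclose using fun m : ℕ => key (1 - 1 / ((m : ℝ) + 2)) (hpos m)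
    (by have : (0 : ℝ) < 1 / ((m : ℝ) + 2) := by positivity
        linarith)
  refine ⟨⋃ m, G m, iUnion_subset hG, le_antisymm ?_ ?_, fun β hβ => ?_⟩
  · exact (dimH_mono (subset_univ _)).trans Real.dimH_univ.le
  · have hlim : Filter.Tendsto (fun m : ℕ => ENNReal.ofReal (1 - 1 / ((m : ℝ) + 2))) Filter.atTop
        (nhds (ENNReal.ofReal (1 - 0))) := by
      refine (ENNReal.continuous_ofReal.tendsto _).comp (Filter.Tendsto.const_sub _ ?_)
      refine Filter.Tendsto.div_atTop tendsto_const_nhds ?_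
      exact Filter.tendsto_atTop_add_const_right _ _ tendsto_natCast_atTop_atTop
    rw [sub_zero, ENNReal.ofReal_one] at hlim
    exact le_of_tendsto' hlim fun m => (hdim m).trans (dimH_mono (subset_iUnion G m))
  · obtain ⟨m, hm⟩ := mem_iUnion.1 hβ
    exact hclose m β hm

lemma exists_event_near (δ : ℝ) (s : ℕ) : ∃ e : ℕ, 2 ^ s ≤ e ∧ e < 2 ^ (s + 1) ∧
    ∃ z : ℤ, |(e : ℝ) / 2 ^ s - δ - z| ≤ 1 / 2 ^ s := by
  set x := Int.fract δ with hx
  have hx0 : 0 ≤ x := Int.fract_nonneg δ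
  have hx1 : x < 1 := Int.fract_lt_one δ
  have hp : (0 : ℝ) < 2 ^ s := by positivity
  have hfl : ⌊2 ^ s * x⌋₊ < 2 ^ s := by
    rw [Nat.floor_lt (by positivity)]
    push_cast
    nlinarith
  refine ⟨2 ^ s + ⌊2 ^ s * x⌋₊, by lia, by rw [pow_succ]; lia, 1 - ⌊δ⌋, ?_⟩
  have h1 : (⌊2 ^ s * x⌋₊ : ℝ) ≤ 2 ^ s * x := Nat.floor_le (by positivity)
  have h2 : 2 ^ s * x < (⌊2 ^ s * x⌋₊ : ℝ) + 1 := Nat.lt_floor_add_one _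
  have h3 : ((2 ^ s + ⌊2 ^ s * x⌋₊ : ℕ) : ℝ) / 2 ^ s - δ - (1 - ⌊δ⌋ : ℤ) =
      (⌊2 ^ s * x⌋₊ - 2 ^ s * x) / 2 ^ s := by
    have : δ = ⌊δ⌋ + x := (Int.floor_add_fract δ).symm
    push_cast
    field_simp
    linear_combination (-2 ^ s) * this
  rw [h3, abs_div, abs_of_pos hp]
  gcongr
  rw [abs_le]
  constructor <;> linarith

lemma log_eq_of_mem {s e : ℕ} (h1 : 2 ^ s ≤ e) (h2 : e < 2 ^ (s + 1)) : Nat.log 2 e = s :=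
  Nat.log_eq_of_pow_le_of_lt_pow h1 h2

lemma lt_loglog_div {C ε n : ℝ} {s : ℕ} (hC : 1 ≤ C) (hε : 0 < ε) (hs : 3840 * C < s)
    (h1 : (2 : ℝ) ^ s / 2 ≤ Real.log n) (h2 : Real.log n ≤ 4 * C * 2 ^ s * (s + 1) ^ 2) :
    15 / 2 ^ s < Real.log (Real.log n) ^ ((3 : ℝ) + ε) / Real.log n := by
  have hlog : 0 < Real.log n := lt_of_lt_of_le (by positivity) h1
  have hs3 : (3840 : ℝ) ≤ s := by nlinarith
  have hll : ((s : ℝ) + 1) / 4 ≤ Real.log (Real.log n) := by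
    have h3 := Real.log_le_log (by positivity) h1
    rw [Real.log_div (by positivity) (by norm_num), Real.log_pow] at h3
    nlinarith [Real.log_two_gt_d9]
  have hpow : (((s : ℝ) + 1) / 4) ^ 3 ≤ Real.log (Real.log n) ^ ((3 : ℝ) + ε) := by
    calc (((s : ℝ) + 1) / 4) ^ 3 ≤ Real.log (Real.log n) ^ 3 := by gcongr
      _ = Real.log (Real.log n) ^ (3 : ℝ) := by rw [← Real.rpow_natCast]; norm_num
      _ ≤ _ := Real.rpow_le_rpow_of_exponent_le (by linarith) (by linarith)
  rw [div_lt_div_iff₀ (by positivity) hlog]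
  have hp : (0 : ℝ) < 2 ^ s := by positivity
  calc 15 * Real.log n ≤ 15 * (4 * C * 2 ^ s * (s + 1) ^ 2) := by gcongr
    _ = 60 * C * (s + 1) ^ 2 * 2 ^ s := by ring
    _ < (((s : ℝ) + 1) / 4) ^ 3 * 2 ^ s := by
        gcongr
        have : (((s : ℝ) + 1) / 4) ^ 3 - 60 * C * (s + 1) ^ 2 =
            (s + 1) ^ 2 * ((s + 1) - 3840 * C) / 64 := by ring
        have h4 : 0 < ((s : ℝ) + 1) ^ 2 * ((s + 1) - 3840 * C) / 64 := by
          have : 0 < (s : ℝ) + 1 - 3840 * C := by linarith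
          positivity
        linarith
    _ ≤ _ := by gcongr

lemma exists_good_times {N : ℕ → ℕ} {C α γ β δ ε : ℝ} (hC : 1 ≤ C) (hε : 0 < ε)
    (h1 : ∀ k, 1 ≤ N k) (h2 : ∀ k, 2 * N k ≤ N (k + 1)) (h3 : ∀ k, Real.log (N k) ≤ C * (k + 1))
    (h4 : ∀ k, N k * nint (N k * α - γ) ≤ 5)
    (hβ : ∃ e₀, ∀ e ≥ e₀, ∃ z : ℤ,
      |N (evK e) * β - (e : ℝ) / 2 ^ Nat.log 2 e - z| ≤ 4 * (1 / 2) ^ evL e) :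
    ∃ m : ℕ → ℕ, StrictMono m ∧ (∀ s, Real.log (m s) ≤ 4 * C * 8 ^ s) ∧ ∃ s₀, ∀ s ≥ s₀,
      1 ≤ m s ∧ (m s : ℝ) * nint (m s * α - γ) * nint (m s * β - δ) <
        Real.log (Real.log (m s)) ^ ((3 : ℝ) + ε) / Real.log (m s) := by
  obtain ⟨e₀, he₀⟩ := hβ
  choose e hle hlt w hw using exists_event_near δ
  have hlog (s : ℕ) : Nat.log 2 (e s) = s := log_eq_of_mem (hle s) (hlt s)
  have hevL (s : ℕ) : evL (e s) = s + 1 := by rw [evL, hlog]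
  have hK (s : ℕ) : evK (e s) = e s * (s + 1) ^ 2 := by rw [evK, hevL]
  have hKmono : StrictMono evK := strictMono_nat_of_lt_succ fun i => by
    have := evK_add_le i
    have : 0 < evL (i + 1) ^ 2 := pow_pos (Nat.succ_pos _) _
    lia
  have hNmono : StrictMono N := strictMono_nat_of_lt_succ fun i => by
    have := h2 i; have := h1 i; lia
  have hemono : StrictMono e := strictMono_nat_of_lt_succ fun s => (hlt s).trans_le (hle (s + 1))
  have hup (s : ℕ) : Real.log (N (evK (e s))) ≤ 4 * C * 2 ^ s * (s + 1) ^ 2 := by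
    have h5 : evK (e s) + 1 ≤ 4 * 2 ^ s * (s + 1) ^ 2 := by
      rw [hK]
      have := hlt s
      rw [pow_succ] at this
      have h6 : 1 ≤ 2 ^ s * (s + 1) ^ 2 := Nat.mul_pos (by positivity) (by positivity)
      nlinarith
    have h6 : ((evK (e s) : ℝ) + 1) ≤ 4 * 2 ^ s * (s + 1) ^ 2 := by exact_mod_cast h5
    calc Real.log (N (evK (e s))) ≤ C * (evK (e s) + 1) := h3 _
      _ ≤ C * (4 * 2 ^ s * (s + 1) ^ 2) := by gcongr
      _ = _ := by ring
  have hlow (s : ℕ) : (2 : ℝ) ^ s / 2 ≤ Real.log (N (evK (e s))) := by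
    have h5 : (2 : ℝ) ^ evK (e s) ≤ N (evK (e s)) := by exact_mod_cast two_pow_le h1 h2 _
    have h6 := Real.log_le_log (by positivity) h5
    rw [Real.log_pow] at h6
    have h7 : (2 : ℝ) ^ s ≤ evK (e s) := by exact_mod_cast (hle s).trans (le_evK _)
    nlinarith [Real.log_two_gt_d9]
  obtain ⟨s₁, hs₁⟩ := exists_nat_gt (3840 * C)
  refine ⟨fun s => N (evK (e s)), hNmono.comp (hKmono.comp hemono), fun s => ?_, max s₁ e₀,
    fun s hs => ⟨h1 _, ?_⟩⟩
  · refine (hup s).trans ?_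
    have h5 : s + 1 ≤ 2 ^ s := Nat.lt_two_pow_self
    have h6 : ((s : ℝ) + 1) ≤ 2 ^ s := by exact_mod_cast h5
    calc 4 * C * 2 ^ s * ((s : ℝ) + 1) ^ 2 ≤ 4 * C * 2 ^ s * (2 ^ s) ^ 2 := by gcongr
      _ = 4 * C * 8 ^ s := by
        rw [show (8 : ℝ) = 2 ^ 3 by norm_num, ← pow_mul, ← pow_mul]; ring
  · have hse : e₀ ≤ e s := (le_max_right s₁ e₀).trans (hs.trans (hemono.le_apply))
    obtain ⟨z, hz⟩ := he₀ (e s) hse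
    rw [hlog, hevL] at hz
    have h5 : nint (N (evK (e s)) * β - δ) ≤ 3 / 2 ^ s := by
      refine (nint_le_abs _ (z + w s)).trans ?_
      have h6 := abs_add_le (N (evK (e s)) * β - (e s : ℝ) / 2 ^ s - z) ((e s : ℝ) / 2 ^ s - δ - w s)
      have h7 : N (evK (e s)) * β - δ - (z + w s : ℤ) =
          (N (evK (e s)) * β - (e s : ℝ) / 2 ^ s - z) + ((e s : ℝ) / 2 ^ s - δ - w s) := by
        push_cast; ring
      rw [h7]
      refine h6.trans ((add_le_add hz (hw s)).trans_eq ?_)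
      rw [one_div_pow, pow_succ]
      field_simp
      norm_num
    have hs' : 3840 * C < s := hs₁.trans_le (by exact_mod_cast (le_max_left s₁ e₀).trans hs)
    refine lt_of_le_of_lt ?_ (lt_loglog_div hC hε hs' (hlow s) (hup s))
    calc (N (evK (e s)) : ℝ) * nint (N (evK (e s)) * α - γ) * nint (N (evK (e s)) * β - δ)
        ≤ 5 * (3 / 2 ^ s) := mul_le_mul (h4 _) h5 (nint_nonneg _) (by norm_num)
      _ = 15 / 2 ^ s := by ring

lemma count_of_good_times {P : ℕ → Prop} {m : ℕ → ℕ} {C : ℝ} (hC : 1 ≤ C) (hm : StrictMono m)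
    (hlog : ∀ s, Real.log (m s) ≤ 4 * C * 8 ^ s) {s₀ : ℕ} (hP : ∀ s ≥ s₀, 1 ≤ m s ∧ P (m s)) :
    ∃ c > 0, ∃ N₀ : ℕ, ∀ N' : ℕ, N₀ ≤ N' →
      c * Real.log (Real.log N') ≤ (Set.ncard {k : ℕ | 1 ≤ k ∧ k ≤ N' ∧ P k} : ℝ) := by
  have hl8 : 0 < Real.log 8 := Real.log_pos (by norm_num)
  have hlim : Filter.Tendsto (fun n : ℕ => Real.log (Real.log n)) Filter.atTop Filter.atTop :=
    Real.tendsto_log_atTop.comp (Real.tendsto_log_atTop.comp tendsto_natCast_atTop_atTop)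
  have hlim' : Filter.Tendsto (fun n : ℕ => Real.log n) Filter.atTop Filter.atTop :=
    Real.tendsto_log_atTop.comp tendsto_natCast_atTop_atTop
  obtain ⟨N₀, hN₀⟩ := Filter.eventually_atTop.1
    ((hlim.eventually_ge_atTop (2 * (Real.log (4 * C) + s₀ * Real.log 8))).and
      ((hlim'.eventually_ge_atTop (4 * C)).and (Filter.eventually_ge_atTop 1)))
  refine ⟨1 / (2 * Real.log 8), by positivity, N₀, fun N' hN' => ?_⟩
  obtain ⟨hY, hY4, hN1⟩ := hN₀ N' hN'
  set Y := Real.log N' with hYdef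
  have hY0 : 0 < Y := by linarith
  set x := Real.log (Y / (4 * C)) / Real.log 8 with hx
  have hx0 : 0 ≤ x := by
    refine div_nonneg (Real.log_nonneg ?_) hl8.le
    rw [le_div_iff₀ (by positivity)]
    linarith
  set S := ⌊x⌋₊ with hS
  have hmem : ∀ s ≤ S, m s ≤ N' := by
    intro s hs
    by_cases hm0 : m s = 0
    · lia
    have hsx : (s : ℝ) ≤ x := (by exact_mod_cast hs : (s : ℝ) ≤ S).trans (Nat.floor_le hx0)
    have h1 : 4 * C * 8 ^ s ≤ Y := by
      rw [hx, le_div_iff₀ hl8, ← Real.log_pow, Real.log_le_log_iff (by positivity) (by positivity),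
        le_div_iff₀ (by positivity)] at hsx
      linarith
    have h2 := (hlog s).trans h1
    rw [hYdef, Real.log_le_log_iff (by exact_mod_cast Nat.pos_of_ne_zero hm0)
      (by exact_mod_cast hN1)] at h2
    exact_mod_cast h2
  have hsub : ((Finset.Icc s₀ S).image m : Set ℕ) ⊆ {k : ℕ | 1 ≤ k ∧ k ≤ N' ∧ P k} := by
    intro k hk
    simp only [Finset.coe_image, Set.mem_image, Finset.coe_Icc, Set.mem_Icc] at hk
    obtain ⟨s, ⟨hs0, hsS⟩, rfl⟩ := hk
    exact ⟨(hP s hs0).1, hmem s hsS, (hP s hs0).2⟩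
  have hfin : {k : ℕ | 1 ≤ k ∧ k ≤ N' ∧ P k}.Finite :=
    (Set.finite_Iic N').subset fun k hk => hk.2.1
  have hcard := Set.ncard_le_ncard hsub hfin
  rw [Set.ncard_coe_finset, Finset.card_image_of_injective _ hm.injective, Nat.card_Icc] at hcard
  have hcard' : x - s₀ ≤ (Set.ncard {k : ℕ | 1 ≤ k ∧ k ≤ N' ∧ P k} : ℝ) := by
    have h1 : S + 1 ≤ Set.ncard {k : ℕ | 1 ≤ k ∧ k ≤ N' ∧ P k} + s₀ := by lia
    have h2 : (S : ℝ) + 1 ≤ Set.ncard {k : ℕ | 1 ≤ k ∧ k ≤ N' ∧ P k} + s₀ := by exact_mod_cast h1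
    have := Nat.lt_floor_add_one x
    linarith
  refine le_trans ?_ hcard'
  rw [hx, Real.log_div hY0.ne' (by positivity), le_sub_iff_add_le, le_div_iff₀ hl8]
  field_simp
  linarith

theorem littlewood_bad_counting (ε : ℝ) (hε : 0 < ε) (α : ℝ) (hα : memK α) (γ : ℝ) :
    ∃ G : Set ℝ, G ⊆ Bad ∧ dimH G = 1 ∧
      ∀ β ∈ G, ∀ δ : ℝ, ∃ c > 0, ∃ N₀ : ℕ, ∀ N' : ℕ, N₀ ≤ N' →
        c * Real.log (Real.log N') ≤ (Set.ncard {m : ℕ | 1 ≤ m ∧ m ≤ N' ∧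
          (m : ℝ) * nint (m * α - γ) * nint (m * β - δ) <
            Real.log (Real.log m) ^ ((3 : ℝ) + ε) / Real.log m} : ℝ) := by
  obtain ⟨N, C, hC, h1, h2, h3, h4⟩ := hα.exists_seq γ
  obtain ⟨G, hG, hdim, hclose⟩ := exists_full_dim_set h1 h2 fun e => (e : ℝ) / 2 ^ Nat.log 2 e
  refine ⟨G, hG, hdim, fun β hβ δ => ?_⟩
  obtain ⟨m, hm, hlog, s₀, hs₀⟩ :=
    exists_good_times (δ := δ) hC hε h1 h2 h3 h4 (hclose β hβ)
  exact count_of_good_times hC hm hlog hs₀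
end

section
/- Let n_1, n_2, … be a strictly increasing sequence of positive integers, let β ∈ [0,1], and let f : ℕ → [0,1] be non-increasing with the doubling property: there exists C > 0 with f(t) ≤ C·f(2t) for all t ≥ 1. Suppose that disp({n_t β mod 1 : T < t ≤ 2T}) = o(f(T)) as T → ∞, i.e. for every c > 0 there exists T_0 such that disp({n_t β mod 1 : T < t ≤ 2T}) ≤ c·f(T) for all integers T ≥ T_0. Then for every δ ∈ ℝ and every c > 0 there are infinitely many positive integers t with ‖n_t β − δ‖ < c·f(t). -/
open Real MeasureTheory Set

theorem nint_le_abs_sub_intCast (x : ℝ) (m : ℤ) : nint x ≤ |x - m| :=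
  ciInf_le ⟨0, by rintro _ ⟨k, rfl⟩; exact abs_nonneg _⟩ m

theorem bddAbove_disp_gaps {A : Set ℝ} (hA : A ⊆ Ico 0 1) :
    BddAbove {d : ℝ |
      (∃ a ∈ A, ∃ b ∈ A, a < b ∧ (∀ x ∈ A, x ≤ a ∨ b ≤ x) ∧ d = b - a) ∨
      (∃ a ∈ A, ∃ b ∈ A, (∀ x ∈ A, b ≤ x ∧ x ≤ a) ∧ d = b + 1 - a)} := by
  refine ⟨1, ?_⟩
  rintro d (⟨a, ha, b, hb, -, -, rfl⟩ | ⟨a, ha, b, hb, h, rfl⟩)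
  · linarith [(hA ha).1, (hA hb).2]
  · linarith [(h a ha).1]

theorem sub_le_disp {A : Set ℝ} (hA : A ⊆ Ico 0 1) {a b : ℝ} (ha : a ∈ A) (hb : b ∈ A)
    (hab : a < b) (h : ∀ x ∈ A, x ≤ a ∨ b ≤ x) : b - a ≤ disp A :=
  le_csSup (bddAbove_disp_gaps hA) (Or.inl ⟨a, ha, b, hb, hab, h, rfl⟩)

theorem add_one_sub_le_disp {A : Set ℝ} (hA : A ⊆ Ico 0 1) {a b : ℝ} (ha : a ∈ A) (hb : b ∈ A)
    (h : ∀ x ∈ A, b ≤ x ∧ x ≤ a) : b + 1 - a ≤ disp A :=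
  le_csSup (bddAbove_disp_gaps hA) (Or.inr ⟨a, ha, b, hb, h, rfl⟩)

theorem disp_pos {A : Set ℝ} (hA : A ⊆ Ico 0 1) (hfin : A.Finite) (hne : A.Nonempty) :
    0 < disp A := by
  obtain ⟨a, ha, hmax⟩ := exists_max_image A id hfin hne
  obtain ⟨b, hb, hmin⟩ := exists_min_image A id hfin hne
  have := add_one_sub_le_disp hA ha hb fun x hx => ⟨hmin x hx, hmax x hx⟩
  linarith [(hA ha).2, (hA hb).1]

/-- Every point of `[0,1)` is within `disp A` of `A`. -/
theorem exists_abs_sub_le_disp {A : Set ℝ} (hA : A ⊆ Ico 0 1) (hfin : A.Finite)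
    (hne : A.Nonempty) {y : ℝ} (hy : y ∈ Ico (0 : ℝ) 1) : ∃ a ∈ A, |a - y| ≤ disp A := by
  obtain ⟨a, ha, hmax⟩ := exists_max_image A id hfin hne
  obtain ⟨b, hb, hmin⟩ := exists_min_image A id hfin hne
  simp only [id] at hmax hmin
  have hwrap := add_one_sub_le_disp hA ha hb fun x hx => ⟨hmin x hx, hmax x hx⟩
  rcases le_or_gt a y with hay | hay
  · refine ⟨a, ha, ?_⟩
    rw [abs_of_nonpos (by linarith)]
    linarith [hy.2, (hA hb).1]
  rcases lt_or_ge y b with hyb | hby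
  · refine ⟨b, hb, ?_⟩
    rw [abs_of_pos (by linarith)]
    linarith [hy.1, (hA ha).2]
  obtain ⟨p, ⟨hp, hpy⟩, hpmax⟩ := exists_max_image (A ∩ Iic y) id (hfin.inter_of_left _) ⟨b, hb, hby⟩
  obtain ⟨q, ⟨hq, hyq⟩, hqmin⟩ := exists_min_image (A ∩ Ioi y) id (hfin.inter_of_left _) ⟨a, ha, hay⟩
  simp only [id, mem_Iic, mem_Ioi] at hpmax hqmin hpy hyq
  have hgap := sub_le_disp hA hp hq (by linarith) fun x hx =>
    (le_or_gt x y).imp (fun h => hpmax x ⟨hx, h⟩) (fun h => hqmin x ⟨hx, h⟩)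
  refine ⟨p, hp, ?_⟩
  rw [abs_of_nonpos (by linarith)]
  linarith

theorem dispersion_implies_approx (n : ℕ → ℕ) (hpos : ∀ t, 1 ≤ t → 0 < n t)
    (hmono : ∀ t, 1 ≤ t → n t < n (t + 1))
    (β : ℝ) (hβ : β ∈ Set.Icc (0 : ℝ) 1)
    (f : ℕ → ℝ) (hf : ∀ t, f t ∈ Set.Icc (0 : ℝ) 1) (hfmono : Antitone f)
    (hdouble : ∃ C > 0, ∀ t : ℕ, 1 ≤ t → f t ≤ C * f (2 * t))
    (hdisp : ∀ c : ℝ, 0 < c → ∃ T₀ : ℕ, ∀ T : ℕ, T₀ ≤ T →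
      disp ((fun t : ℕ => Int.fract ((n t : ℝ) * β)) '' {t : ℕ | T < t ∧ t ≤ 2 * T}) ≤
        c * f T) :
    ∀ δ : ℝ, ∀ c : ℝ, 0 < c →
      Set.Infinite {t : ℕ | 0 < t ∧ nint ((n t : ℝ) * β - δ) < c * f t} := by
  intro δ c hc
  obtain ⟨C, hC, hdouble⟩ := hdouble
  obtain ⟨T₀, hT₀⟩ := hdisp (c / (2 * C)) (by positivity)
  refine infinite_of_forall_exists_gt fun N => ?_
  obtain ⟨T, hTT₀, hTN, hT1⟩ : ∃ T : ℕ, T₀ ≤ T ∧ N ≤ T ∧ 1 ≤ T :=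
    ⟨T₀ + N + 1, by omega, by omega, by omega⟩
  have hT := hT₀ T hTT₀
  set A : Set ℝ := (fun t : ℕ => Int.fract ((n t : ℝ) * β)) '' {t : ℕ | T < t ∧ t ≤ 2 * T}
  have hA : A ⊆ Ico 0 1 := by
    rintro _ ⟨t, -, rfl⟩
    exact ⟨Int.fract_nonneg _, Int.fract_lt_one _⟩
  have hfin : A.Finite := (finite_Ioc T (2 * T)).image _
  have hne : A.Nonempty := ⟨_, T + 1, ⟨by omega, by omega⟩, rfl⟩
  have hpos' := disp_pos hA hfin hne
  obtain ⟨_, ⟨t, ⟨htT, ht2T⟩, rfl⟩, hta⟩ := exists_abs_sub_le_disp hA hfin hne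
    (y := Int.fract δ) ⟨Int.fract_nonneg _, Int.fract_lt_one _⟩
  refine ⟨t, ⟨by omega, ?_⟩, by omega⟩
  have hnint : nint ((n t : ℝ) * β - δ) ≤ disp A := by
    refine (nint_le_abs_sub_intCast _ (⌊(n t : ℝ) * β⌋ - ⌊δ⌋)).trans (le_of_eq_of_le ?_ hta)
    simp only [Int.fract]
    push_cast
    congr 1
    ring
  have hft : c / (2 * C) * f T ≤ c / 2 * f t :=
    calc c / (2 * C) * f T ≤ c / (2 * C) * (C * f t) := by
          gcongr
          exact (hdouble T hT1).trans (by gcongr; exact hfmono ht2T)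
      _ = c / 2 * f t := by field_simp
  linarith
end
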